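/- arXiv:math/0703600 — 5 statements merged into one kernel-verified Lean document; each statement's English description precedes it below -/
import Mathlib

section
/- Let λ > 0, A = λ(1+λ)/2, and f(z) = (1 + 4A(1 − cos z))^{−1/2}. Then for all real z with |z| ≤ (1/10)(1+λ)^{−1}, one has 0 ≤ f(z) ≤ exp( −Az² + ( A/12 + A² ) z⁴ ). -/
open Real

theorem cos_le_one_sub_sq_div_two_add_pow_four_div {x : ℝ} (hx : |x| ≤ 1) :
    cos x ≤ 1 - x ^ 2 / 2 + x ^ 4 / 24 := by
  have h0 := abs_nonneg x
  have hsin : |x| / 2 - (|x| / 2) ^ 3 / 6 ≤ sin (|x| / 2) := sin_ge_sub_cube (by positivity)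
  have hnonneg : 0 ≤ |x| / 2 - (|x| / 2) ^ 3 / 6 := by
    nlinarith [pow_le_one₀ h0 hx (n := 2)]
  have hsq := pow_le_pow_left₀ hnonneg hsin 2
  have hcos : cos x = 1 - 2 * sin (|x| / 2) ^ 2 := by
    rw [← cos_abs, show |x| = 2 * (|x| / 2) by ring, cos_two_mul, cos_sq']
    ring_nf
  have h2 : |x| ^ 2 = x ^ 2 := sq_abs x
  have h4 : |x| ^ 4 = x ^ 4 := by rw [show 4 = 2 * 2 from rfl, pow_mul, pow_mul, h2]
  have h6 : 0 ≤ |x| ^ 6 := by positivity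
  rw [hcos]
  nlinarith

theorem sub_sq_div_two_le_log_one_add {v : ℝ} (hv : 0 ≤ v) : v - v ^ 2 / 2 ≤ log (1 + v) := by
  refine le_trans ?_ (le_log_one_add_of_nonneg hv)
  rw [le_div_iff₀ (by positivity)]
  nlinarith [pow_nonneg hv 3]

theorem rpow_neg_half_le_exp {A z : ℝ} (hA : 0 ≤ A) (hz : |z| ≤ 1) :
    (1 + 4 * A * (1 - cos z)) ^ (-(1 : ℝ) / 2) ≤ exp (-A * z ^ 2 + (A / 12 + A ^ 2) * z ^ 4) := by
  have hz2 : z ^ 2 ≤ 1 := (sq_le_one_iff_abs_le_one z).mpr hz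
  set v := 2 * A * z ^ 2 - A * z ^ 4 / 6 with hv
  have hAz : 0 ≤ A * z ^ 2 := by positivity
  have hAz4 : 0 ≤ A * z ^ 4 := by positivity
  have hv0 : 0 ≤ v := by nlinarith
  have hvle : v ≤ 2 * (A * z ^ 2) := by linarith
  have hvu : 1 + v ≤ 1 + 4 * A * (1 - cos z) := by
    nlinarith [mul_le_mul_of_nonneg_left (cos_le_one_sub_sq_div_two_add_pow_four_div hz) hA]
  have hlog : v - v ^ 2 / 2 ≤ log (1 + 4 * A * (1 - cos z)) :=
    (sub_sq_div_two_le_log_one_add hv0).trans (log_le_log (by linarith) hvu)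
  have hsq := pow_le_pow_left₀ hv0 hvle 2
  rw [rpow_def_of_pos (by linarith), exp_le_exp]
  nlinarith

/-- With `A = λ(1+λ)/2` and `f(z) = (1 + 4A(1−cos z))^{−1/2}`, for `|z| ≤ (1/10)(1+λ)⁻¹`
one has `0 ≤ f(z) ≤ exp(−Az² + (A/12 + A²)z⁴)`. -/
theorem stmt_6 (lam : ℝ) (hlam : 0 < lam) (z : ℝ)
    (hz : |z| ≤ (1 / 10) * (1 + lam)⁻¹) :
    0 ≤ (1 + 4 * (lam * (1 + lam) / 2) * (1 - cos z)) ^ (-(1 : ℝ) / 2)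
    ∧ (1 + 4 * (lam * (1 + lam) / 2) * (1 - cos z)) ^ (-(1 : ℝ) / 2)
        ≤ exp (-(lam * (1 + lam) / 2) * z ^ 2
            + ((lam * (1 + lam) / 2) / 12 + (lam * (1 + lam) / 2) ^ 2) * z ^ 4) := by
  have hinv : (1 + lam)⁻¹ ≤ 1 := inv_le_one_of_one_le₀ (by linarith)
  have hcos := cos_le_one z
  exact ⟨rpow_nonneg (add_nonneg zero_le_one
    (mul_nonneg (by positivity) (by linarith))) _,
    rpow_neg_half_le_exp (by positivity) (by linarith)⟩
end

section
/- There is an absolute constant C > 0 such that for all real λ > 0 and all real K ≥ 1 the following holds. Let A = λ(1+λ)/2, N = ⌈6000(1+λ)⌉, δ = 2π/N, and g(x) = −Ax² + ( (9/4)A + 27A² ) x⁴. Then ∫_{−30δ}^{30δ} exp(K·g(x)) dx ≤ √(π/(AK)) · exp( C·( K^{−1} + (AK)^{−1} ) ). -/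
open Real

/-- Pointwise domination of `exp (-a x² + b x⁴)` by Gaussians where the quartic term is small. -/
theorem exp_quartic_le {a b x : ℝ} (ha : 0 < a) (hx : b * x ^ 2 ≤ a / 2) :
    exp (-a * x ^ 2 + b * x ^ 4)
      ≤ exp (-a * x ^ 2) + 32 * (|b| / a ^ 2) * exp (-(a / 4) * x ^ 2) := by
  have h₁ : exp (b * x ^ 4) ≤ 1 + b * x ^ 4 * exp (b * x ^ 4) := by
    have h := mul_le_mul_of_nonneg_right (add_one_le_exp (-(b * x ^ 4))) (exp_pos (b * x ^ 4)).le
    rw [← exp_add, neg_add_cancel, exp_zero] at h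
    linarith
  have h₂ : (a * x ^ 2) ^ 2 ≤ 32 * exp (a / 4 * x ^ 2) := by
    have h := quadratic_le_exp_of_nonneg (x := a / 4 * x ^ 2) (by positivity)
    nlinarith [show 0 ≤ a / 4 * x ^ 2 by positivity]
  have h₃ : b * x ^ 4 ≤ |b| / a ^ 2 * (32 * exp (a / 4 * x ^ 2)) :=
    calc b * x ^ 4 ≤ |b| * x ^ 4 := mul_le_mul_of_nonneg_right (le_abs_self b) (by positivity)
      _ = |b| / a ^ 2 * (a * x ^ 2) ^ 2 := by field_simp
      _ ≤ _ := mul_le_mul_of_nonneg_left h₂ (by positivity)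
  have h₄ : exp (-a * x ^ 2 + b * x ^ 4) ≤ exp (-(a / 2) * x ^ 2) := by
    rw [exp_le_exp]
    nlinarith [mul_le_mul_of_nonneg_right hx (sq_nonneg x)]
  calc exp (-a * x ^ 2 + b * x ^ 4)
      ≤ exp (-a * x ^ 2) + b * x ^ 4 * exp (-a * x ^ 2 + b * x ^ 4) := by
        have h := mul_le_mul_of_nonneg_left h₁ (exp_pos (-a * x ^ 2)).le
        rw [exp_add]
        linarith
    _ ≤ exp (-a * x ^ 2)
        + |b| / a ^ 2 * (32 * exp (a / 4 * x ^ 2)) * exp (-(a / 2) * x ^ 2) := by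
        gcongr
    _ = _ := by
        rw [show -(a / 4) * x ^ 2 = a / 4 * x ^ 2 + -(a / 2) * x ^ 2 by ring, exp_add]
        ring

/-- Laplace-type upper bound for `∫ exp (-a x² + b x⁴)` over an interval where the quartic term is
at most half of the quadratic one. -/
theorem integral_exp_quartic_le {a b R : ℝ} (ha : 0 < a) (hb : 0 ≤ b) (hR : 0 ≤ R)
    (hbR : b * R ^ 2 ≤ a / 2) :
    ∫ x in (-R)..R, exp (-a * x ^ 2 + b * x ^ 4) ≤ √(π / a) * exp (64 * (b / a ^ 2)) := by
  have hi₁ := integrable_exp_neg_mul_sq ha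
  have hi₂ := (integrable_exp_neg_mul_sq (show 0 < a / 4 by positivity)).const_mul
    (32 * (|b| / a ^ 2))
  have hi := hi₁.add hi₂
  have hsqrt : √(π / (a / 4)) = 2 * √(π / a) := by
    rw [show π / (a / 4) = 2 ^ 2 * (π / a) by field_simp; norm_num, sqrt_mul (by positivity),
      sqrt_sq (by norm_num)]
  calc ∫ x in (-R)..R, exp (-a * x ^ 2 + b * x ^ 4)
      ≤ ∫ x in (-R)..R, (exp (-a * x ^ 2) + 32 * (|b| / a ^ 2) * exp (-(a / 4) * x ^ 2)) := by
        refine intervalIntegral.integral_mono_on (by linarith)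
          (Continuous.intervalIntegrable (by fun_prop) _ _)
          (Continuous.intervalIntegrable (by fun_prop) _ _) fun x hx => ?_
        refine exp_quartic_le ha (le_trans ?_ hbR)
        exact mul_le_mul_of_nonneg_left (sq_le_sq' hx.1 hx.2) hb
    _ ≤ ∫ x, (exp (-a * x ^ 2) + 32 * (|b| / a ^ 2) * exp (-(a / 4) * x ^ 2)) := by
        rw [intervalIntegral.integral_of_le (by linarith)]
        exact MeasureTheory.setIntegral_le_integral hi (Filter.Eventually.of_forall fun x => by
          simp only [Pi.zero_apply]
          positivity)
    _ = √(π / a) * (64 * (b / a ^ 2) + 1) := by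
        rw [MeasureTheory.integral_add hi₁ hi₂, MeasureTheory.integral_const_mul,
          integral_gaussian, integral_gaussian, hsqrt, abs_of_nonneg hb]
        ring
    _ ≤ _ := by gcongr; exact add_one_le_exp _

/-- Lemma 4 of the paper: there is an absolute constant `C > 0` such that for all `λ > 0`
and `K ≥ 1`, with `A = λ(1+λ)/2`, `δ = 2π/⌈6000(1+λ)⌉` and
`g(x) = −Ax² + ((9/4)A + 27A²)x⁴`,
`∫_{−30δ}^{30δ} exp(K g(x)) dx ≤ √(π/(AK)) exp(C(K⁻¹ + (AK)⁻¹))`. -/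
theorem stmt_7 :
    ∃ C : ℝ, 0 < C ∧ ∀ lam K : ℝ, 0 < lam → 1 ≤ K →
      (∫ x in (-(30 * (2 * π / (⌈6000 * (1 + lam)⌉₊ : ℝ))))..(30 * (2 * π / (⌈6000 * (1 + lam)⌉₊ : ℝ))),
          exp (K * (-(lam * (1 + lam) / 2) * x ^ 2
            + ((9 / 4) * (lam * (1 + lam) / 2) + 27 * (lam * (1 + lam) / 2) ^ 2) * x ^ 4)))
        ≤ Real.sqrt (π / ((lam * (1 + lam) / 2) * K))
            * exp (C * (K⁻¹ + ((lam * (1 + lam) / 2) * K)⁻¹)) := by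
  refine ⟨1728, by norm_num, fun lam K hlam hK => ?_⟩
  have hK₀ : 0 < K := by linarith
  have hA : 0 < lam * (1 + lam) / 2 := by positivity
  have hA' : lam * (1 + lam) / 2 ≤ (1 + lam) ^ 2 / 2 := by nlinarith
  set A := lam * (1 + lam) / 2
  have hN : 6000 * (1 + lam) ≤ (⌈6000 * (1 + lam)⌉₊ : ℝ) := Nat.le_ceil _
  set N : ℝ := (⌈6000 * (1 + lam)⌉₊ : ℝ)
  have hN₀ : 0 < N := by nlinarith
  have hR₀ : 0 ≤ 30 * (2 * π / N) := by positivity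
  have hR : 30 * (2 * π / N) * (1 + lam) ≤ 1 / 25 := by
    rw [← mul_div_assoc, div_mul_eq_mul_div, div_le_iff₀ hN₀]
    nlinarith [pi_le_four]
  set R := 30 * (2 * π / N)
  have hR2 : R ^ 2 * (1 + lam) ^ 2 ≤ (1 / 25) ^ 2 := by
    rw [← mul_pow]
    exact pow_le_pow_left₀ (by positivity) hR 2
  have hfac : (9 / 4 + 27 * A) * R ^ 2 ≤ 1 / 2 := by
    have h : 9 / 4 + 27 * A ≤ 16 * (1 + lam) ^ 2 := by nlinarith
    nlinarith [mul_le_mul_of_nonneg_right h (sq_nonneg R)]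
  have hbR : K * (9 / 4 * A + 27 * A ^ 2) * R ^ 2 ≤ A * K / 2 := by
    nlinarith [mul_le_mul_of_nonneg_left hfac (mul_pos hA hK₀).le]
  have hmain := integral_exp_quartic_le (mul_pos hA hK₀)
    (show 0 ≤ K * (9 / 4 * A + 27 * A ^ 2) by positivity) hR₀ hbR
  calc _ = ∫ x in (-R)..R, exp (-(A * K) * x ^ 2 + K * (9 / 4 * A + 27 * A ^ 2) * x ^ 4) := by
        congr 1 with x
        ring_nf
    _ ≤ _ := hmain
    _ ≤ _ := by
        refine mul_le_mul_of_nonneg_left (exp_le_exp.2 ?_) (sqrt_nonneg _)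
        have h : 64 * (K * (9 / 4 * A + 27 * A ^ 2) / (A * K) ^ 2)
            = 144 * (A * K)⁻¹ + 1728 * K⁻¹ := by
          field_simp
          ring
        have : 0 < (A * K)⁻¹ := by positivity
        linarith
end

section
/- Let m, s, n, t be positive integers with ms = nt and let λ = s/n = t/m. Then M(m,s;n,t) = (2π)^{−(m+n)} · ( λ^{−λ} (1+λ)^{1+λ} )^{mn} · ∫_{[−π,π]^{m+n}} e^{−is∑_{j=1}^m θ_j − it∑_{k=1}^n φ_k} ∏_{j=1}^m ∏_{k=1}^n (1 − λ(e^{i(θ_j+φ_k)} − 1))^{−1} dθ dφ, where the integral is over θ ∈ [−π,π]^m and φ ∈ [−π,π]^n (and its value, after multiplication by the stated real prefactor, is the real number M(m,s;n,t)). -/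
open Real MeasureTheory

/-- `M(m,s;n,t)`: the number of `m × n` matrices with nonnegative integer entries whose
rows each sum to `s` and whose columns each sum to `t`. -/
noncomputable def matCount (m s n t : ℕ) : ℕ :=
  Nat.card {A : Fin m → Fin n → ℕ // (∀ j, ∑ k, A j k = s) ∧ (∀ k, ∑ j, A j k = t)}

lemma isCompact_box (m n : ℕ) :
    IsCompact ((Set.univ.pi fun _ : Fin m => Set.Icc (-π) π) ×ˢ
      (Set.univ.pi fun _ : Fin n => Set.Icc (-π) π)) :=
  (isCompact_univ_pi fun _ => isCompact_Icc).prod (isCompact_univ_pi fun _ => isCompact_Icc)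

/-- Orthogonality of characters on `[-π, π]`. -/
lemma setIntegral_Icc_exp_int_mul (a : ℤ) :
    ∫ x in Set.Icc (-π) π, Complex.exp (Complex.I * (a * (x : ℂ)))
      = if a = 0 then (2 * π : ℂ) else 0 := by
  rw [integral_Icc_eq_integral_Ioc, ← intervalIntegral.integral_of_le (by linarith [pi_pos])]
  split_ifs with h
  · subst h
    simp
    ring
  · have hc : Complex.I * a ≠ 0 := mul_ne_zero Complex.I_ne_zero (by exact_mod_cast h)
    simp_rw [← mul_assoc]
    rw [integral_exp_mul_complex hc, div_eq_zero_iff, sub_eq_zero]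
    left
    rw [Complex.exp_eq_exp_iff_exists_int]
    exact ⟨a, by push_cast; ring⟩

lemma setIntegral_pi_Icc_prod_exp_int_mul (m : ℕ) (a : Fin m → ℤ) :
    ∫ x in Set.univ.pi fun _ : Fin m => Set.Icc (-π) π,
        ∏ j, Complex.exp (Complex.I * (a j * (x j : ℂ)))
      = if ∀ j, a j = 0 then (2 * π : ℂ) ^ m else 0 := by
  rw [volume_pi, Measure.restrict_pi_pi,
    integral_fintype_prod_eq_prod (𝕜 := ℂ)
      (fun j (x : ℝ) => Complex.exp (Complex.I * (a j * (x : ℂ))))]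
  simp_rw [setIntegral_Icc_exp_int_mul]
  rw [Finset.prod_ite_zero]
  simp

/-- The character `(θ, φ) ↦ e^{-i(s ∑ θ + t ∑ φ)} ∏ e^{i (θ_j + φ_k) A_{jk}}` integrates to
`(2π)^{m+n}` if `A` has row sums `s` and column sums `t`, and to `0` otherwise. -/
lemma setIntegral_matrix_character (m s n t : ℕ) (A : Fin m → Fin n → ℕ) :
    ∫ p in (Set.univ.pi fun _ : Fin m => Set.Icc (-π) π) ×ˢ
          (Set.univ.pi fun _ : Fin n => Set.Icc (-π) π),
        Complex.exp (-(Complex.I * ((s : ℝ) * ∑ j, p.1 j + (t : ℝ) * ∑ k, p.2 k)))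
          * ∏ j, ∏ k, Complex.exp (Complex.I * ((p.1 j : ℝ) + p.2 k)) ^ A j k
      = if (∀ j, ∑ k, A j k = s) ∧ (∀ k, ∑ j, A j k = t) then (2 * π : ℂ) ^ (m + n) else 0 := by
  have factor (p : (Fin m → ℝ) × (Fin n → ℝ)) :
      Complex.exp (-(Complex.I * ((s : ℝ) * ∑ j, p.1 j + (t : ℝ) * ∑ k, p.2 k)))
          * ∏ j, ∏ k, Complex.exp (Complex.I * ((p.1 j : ℝ) + p.2 k)) ^ A j k
        = (∏ j, Complex.exp (Complex.I * (((∑ k, A j k : ℤ) - s : ℤ) * (p.1 j : ℂ))))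
          * ∏ k, Complex.exp (Complex.I * (((∑ j, A j k : ℤ) - t : ℤ) * (p.2 k : ℂ))) := by
    simp_rw [← Complex.exp_nat_mul, ← Complex.exp_sum, ← Complex.exp_add]
    congr 1
    push_cast
    simp only [sub_mul, mul_sub, mul_add, Finset.sum_add_distrib, Finset.sum_sub_distrib,
      Finset.sum_mul, Finset.mul_sum]
    rw [Finset.sum_comm (f := fun (k : Fin n) (j : Fin m) => Complex.I * (A j k * (p.2 k : ℂ)))]
    simp only [mul_left_comm]
    ring
  simp_rw [factor]
  rw [Measure.volume_eq_prod, setIntegral_prod_mul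
    (fun x : Fin m → ℝ => ∏ j, Complex.exp (Complex.I * (((∑ k, A j k : ℤ) - s : ℤ) * (x j : ℂ))))
    (fun y : Fin n → ℝ => ∏ k, Complex.exp (Complex.I * (((∑ j, A j k : ℤ) - t : ℤ) * (y k : ℂ)))),
    setIntegral_pi_Icc_prod_exp_int_mul, setIntegral_pi_Icc_prod_exp_int_mul]
  have cast_iff (u v : ℕ) : (u : ℤ) - v = 0 ↔ u = v := by omega
  simp_rw [← Nat.cast_sum, cast_iff, ite_zero_mul_ite_zero, pow_add]

lemma matCount_eq_card_filter (m s n t N : ℕ) (hN : s < N) :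
    matCount m s n t
      = ((Fintype.piFinset fun _ : Fin m => Fintype.piFinset fun _ : Fin n => Finset.range N).filter
          fun A => (∀ j, ∑ k, A j k = s) ∧ (∀ k, ∑ j, A j k = t)).card := by
  refine Nat.subtype_card _ fun A => ?_
  simp only [Finset.mem_filter, Fintype.mem_piFinset, Finset.mem_range, and_iff_right_iff_imp]
  intro hA j k
  calc A j k ≤ ∑ k, A j k := Finset.single_le_sum_of_canonicallyOrdered (Finset.mem_univ k)
    _ = s := hA.1 j
    _ < N := hN

/-- The truncation of the geometric series at any order above `s` already has the
right integral. -/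
lemma setIntegral_truncated (m s n t N : ℕ) (hN : s < N) (q : ℂ) :
    ∫ p in (Set.univ.pi fun _ : Fin m => Set.Icc (-π) π) ×ˢ
          (Set.univ.pi fun _ : Fin n => Set.Icc (-π) π),
        Complex.exp (-(Complex.I * ((s : ℝ) * ∑ j, p.1 j + (t : ℝ) * ∑ k, p.2 k)))
          * ∏ j, ∏ k, ∑ a ∈ Finset.range N,
              (q * Complex.exp (Complex.I * ((p.1 j : ℝ) + p.2 k))) ^ a
      = (2 * π : ℂ) ^ (m + n) * q ^ (m * s) * matCount m s n t := by
  have expand (p : (Fin m → ℝ) × (Fin n → ℝ)) :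
      Complex.exp (-(Complex.I * ((s : ℝ) * ∑ j, p.1 j + (t : ℝ) * ∑ k, p.2 k)))
          * ∏ j, ∏ k, ∑ a ∈ Finset.range N,
              (q * Complex.exp (Complex.I * ((p.1 j : ℝ) + p.2 k))) ^ a
        = ∑ A ∈ Fintype.piFinset fun _ : Fin m => Fintype.piFinset fun _ : Fin n => Finset.range N,
            q ^ (∑ j, ∑ k, A j k) *
              (Complex.exp (-(Complex.I * ((s : ℝ) * ∑ j, p.1 j + (t : ℝ) * ∑ k, p.2 k)))
                * ∏ j, ∏ k, Complex.exp (Complex.I * ((p.1 j : ℝ) + p.2 k)) ^ A j k) := by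
    simp_rw [Finset.prod_univ_sum, Finset.mul_sum, mul_pow, Finset.prod_mul_distrib,
      Finset.prod_pow_eq_pow_sum]
    exact Finset.sum_congr rfl fun A _ => by ring
  simp_rw [expand]
  rw [integral_finsetSum]
  · simp_rw [integral_const_mul, setIntegral_matrix_character, mul_ite, mul_zero]
    rw [← Finset.sum_filter, matCount_eq_card_filter m s n t N hN]
    rw [Finset.sum_congr rfl (g := fun _ => (2 * π : ℂ) ^ (m + n) * q ^ (m * s))]
    · simp [mul_comm]
    · intro A hA
      simp [(Finset.mem_filter.mp hA).2.1, mul_comm]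
  · intro A _
    exact ContinuousOn.integrableOn_compact (isCompact_box m n) (by fun_prop)

/-- The integral representation with the factors `(1 - q z)⁻¹` for an arbitrary `q ∈ [0, 1)`. -/
lemma setIntegral_prod_geometric (m s n t : ℕ) (q : ℝ) (hq : 0 ≤ q) (hq1 : q < 1) :
    ∫ p in (Set.univ.pi fun _ : Fin m => Set.Icc (-π) π) ×ˢ
          (Set.univ.pi fun _ : Fin n => Set.Icc (-π) π),
        Complex.exp (-(Complex.I * ((s : ℝ) * ∑ j, p.1 j + (t : ℝ) * ∑ k, p.2 k)))
          * ∏ j, ∏ k, (1 - q * Complex.exp (Complex.I * ((p.1 j : ℝ) + p.2 k)))⁻¹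
      = (2 * π : ℂ) ^ (m + n) * (q : ℂ) ^ (m * s) * matCount m s n t := by
  have norm_z (x y : ℝ) : ‖(q : ℂ) * Complex.exp (Complex.I * ((x : ℝ) + y))‖ = q := by
    rw [norm_mul, mul_comm Complex.I, ← Complex.ofReal_add, Complex.norm_exp_ofReal_mul_I, mul_one,
      Complex.norm_real, Real.norm_of_nonneg hq]
  have norm_e (x : ℝ) : ‖Complex.exp (-(Complex.I * x))‖ = 1 := by
    rw [← mul_neg, mul_comm, ← Complex.ofReal_neg, Complex.norm_exp_ofReal_mul_I]
  refine tendsto_nhds_unique (tendsto_integral_of_dominated_convergence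
    (F := fun N (p : (Fin m → ℝ) × (Fin n → ℝ)) =>
      Complex.exp (-(Complex.I * ((s : ℝ) * ∑ j, p.1 j + (t : ℝ) * ∑ k, p.2 k)))
          * ∏ j, ∏ k, ∑ a ∈ Finset.range N,
              (q * Complex.exp (Complex.I * ((p.1 j : ℝ) + p.2 k))) ^ a)
    (fun _ => ∏ _j : Fin m, ∏ _k : Fin n, (1 - q)⁻¹) ?_ ?_ ?_ ?_)
    (tendsto_const_nhds.congr' ?_)
  · intro N
    exact Continuous.aestronglyMeasurable (by fun_prop)
  · exact continuousOn_const.integrableOn_compact (isCompact_box m n)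
  · intro N
    refine ae_of_all _ fun p => ?_
    have : ‖Complex.exp (-(Complex.I * ((s : ℝ) * ∑ j, p.1 j + (t : ℝ) * ∑ k, p.2 k)))‖ = 1 := by
      exact_mod_cast norm_e ((s : ℝ) * ∑ j, p.1 j + (t : ℝ) * ∑ k, p.2 k)
    rw [norm_mul, this, one_mul]
    simp_rw [norm_prod]
    gcongr with j _ k _
    refine (norm_sum_le _ _).trans ?_
    simp_rw [norm_pow, norm_z]
    rw [← tsum_geometric_of_lt_one hq hq1]
    exact (summable_geometric_of_lt_one hq hq1).sum_le_tsum _ fun _ _ => by positivity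
  · refine ae_of_all _ fun p => tendsto_const_nhds.mul ?_
    refine tendsto_finsetProd _ fun j _ => tendsto_finsetProd _ fun k _ => ?_
    exact (hasSum_geometric_of_norm_lt_one (by rw [norm_z]; exact hq1)).tendsto_sum_nat
  · filter_upwards [Filter.eventually_gt_atTop s] with N hN
    exact (setIntegral_truncated m s n t N hN q).symm

/-- The prefactor cancels the weight of each matrix and the normalisation of the factors. -/
lemma prefactor_mul_weight (m s n : ℕ) (hs : 0 < s) (hn : 0 < n) :
    (((s : ℝ) / n) ^ (-((s : ℝ) / n)) * (1 + (s : ℝ) / n) ^ (1 + (s : ℝ) / n)) ^ (m * n)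
      * (((1 + (s : ℝ) / n)⁻¹) ^ (m * n) * ((s : ℝ) / n / (1 + (s : ℝ) / n)) ^ (m * s)) = 1 := by
  have hn' : (n : ℝ) ≠ 0 := by positivity
  have hx : 0 < (s : ℝ) / n := by positivity
  have hmul : (s : ℝ) / n * (m * n : ℕ) = (m * s : ℕ) := by
    push_cast
    field_simp
  generalize (s : ℝ) / n = x at *
  have hy : 0 < 1 + x := by positivity
  rw [mul_pow, ← Real.rpow_mul_natCast hx.le, ← Real.rpow_mul_natCast hy.le, neg_mul, add_mul,
    one_mul, hmul, Real.rpow_neg hx.le, Real.rpow_add hy, Real.rpow_natCast, Real.rpow_natCast,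
    Real.rpow_natCast, div_pow, inv_pow]
  field_simp

/-- The Fourier-integral (saddle point) representation of `M(m,s;n,t)`:
`M = (2π)^{−(m+n)} (λ^{−λ}(1+λ)^{1+λ})^{mn} ∫_{[−π,π]^{m+n}} F(θ,φ) dθ dφ`,
where `λ = s/n = t/m` and
`F(θ,φ) = e^{−is∑θ_j − it∑φ_k} ∏_{j,k} (1 − λ(e^{i(θ_j+φ_k)} − 1))⁻¹`. -/
theorem stmt_9 (m s n t : ℕ) (hm : 0 < m) (hs : 0 < s) (hn : 0 < n) (ht : 0 < t)
    (hst : m * s = n * t) :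
    (matCount m s n t : ℂ)
      = (((((2 * π) ^ (m + n))⁻¹ *
            (((s : ℝ) / n) ^ (-((s : ℝ) / n)) * (1 + (s : ℝ) / n) ^ (1 + (s : ℝ) / n))
              ^ (m * n) : ℝ)) : ℂ)
          * ∫ p in
              ((Set.univ.pi fun _ : Fin m => Set.Icc (-π) π) ×ˢ
                (Set.univ.pi fun _ : Fin n => Set.Icc (-π) π)),
              Complex.exp (-(Complex.I * ((s : ℝ) * ∑ j, p.1 j + (t : ℝ) * ∑ k, p.2 k)))
                * ∏ j, ∏ k,
                    (1 - (((s : ℝ) / n : ℝ) : ℂ)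
                        * (Complex.exp (Complex.I * ((p.1 j : ℝ) + p.2 k)) - 1))⁻¹ := by
  have hx : 0 < (s : ℝ) / n := by positivity
  have weight := prefactor_mul_weight m s n hs hn
  set x : ℝ := (s : ℝ) / n
  have hy : 0 < 1 + x := by positivity
  have hy' : (1 + x : ℂ) ≠ 0 := by exact_mod_cast hy.ne'
  have factor (z : ℂ) :
      (1 - (x : ℂ) * (z - 1))⁻¹ = (1 + x : ℂ)⁻¹ * (1 - (x / (1 + x) : ℝ) * z)⁻¹ := by
    rw [← mul_inv]
    congr 1
    push_cast
    field_simp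
    ring
  simp_rw [factor, Finset.prod_mul_distrib, Finset.prod_const, mul_left_comm (Complex.exp _)]
  rw [integral_const_mul, setIntegral_prod_geometric m s n t _ (by positivity)
    ((div_lt_one hy).2 (by linarith))]
  have weight' := congrArg (fun r : ℝ => (r : ℂ)) weight
  have hpi : (π : ℂ) ≠ 0 := by exact_mod_cast pi_ne_zero
  simp only [Complex.ofReal_mul, Complex.ofReal_one, Complex.ofReal_pow, Complex.ofReal_inv,
    Complex.ofReal_add, Complex.ofReal_ofNat, Finset.card_univ, Fintype.card_fin, ← pow_mul]
    at weight' ⊢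
  rw [mul_comm n m]
  have htwo : ((2 * π : ℂ) ^ (m + n))⁻¹ * (2 * π : ℂ) ^ (m + n) = 1 :=
    inv_mul_cancel₀ (pow_ne_zero _ (mul_ne_zero two_ne_zero hpi))
  linear_combination -(matCount m s n t : ℂ) * weight' -
    (matCount m s n t : ℂ) * (((x ^ (-x) : ℝ) * ((1 + x) ^ (1 + x) : ℝ) : ℂ) ^ (m * n) *
      ((1 + x : ℂ)⁻¹ ^ (m * n) * (x / (1 + x) : ℝ) ^ (m * s))) * htwo
end

section
/- Let m, n ≥ 2 be integers, set s₀ = lcm(m,n)/m, t₀ = lcm(m,n)/n, and d = (m−1)(n−1). Then there exists a function g : {0,1,…,d} → ℝ with g(k) ≥ 0 for all k, such that for every integer q ≥ d, M(m, q s₀; n, q t₀) = binom(q, d) · ∑_{X ⊆ {0,1,…,d−1}} g(|X|) / ∏_{j∈X} (q − j), where the sum is over all subsets X of {0,1,…,d−1}. -/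
open Finset

/-- `f` is a nonnegative combination of the functions `r ↦ r.choose k` with `k ≤ d`. -/
def BinomPos (d : ℕ) (f : ℕ → ℕ) : Prop :=
  ∃ a : ℕ → ℕ, ∀ r, f r = ∑ k ∈ range (d + 1), a k * r.choose k

namespace BinomPos

lemma const (c : ℕ) : BinomPos 0 fun _ => c :=
  ⟨fun _ => c, fun r => by simp⟩

lemma mono {d d' : ℕ} {f : ℕ → ℕ} (h : BinomPos d f) (hd : d ≤ d') : BinomPos d' f := by
  obtain ⟨a, ha⟩ := h
  refine ⟨fun k => if k < d + 1 then a k else 0, fun r => ?_⟩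
  rw [ha, ← sum_subset (range_mono (Nat.succ_le_succ hd))]
  · refine sum_congr rfl fun k hk => ?_
    have : k < d + 1 := mem_range.1 hk
    simp only [if_pos this]
  · intro k _ hk
    have : ¬k < d + 1 := by simpa using hk
    simp only [if_neg this, zero_mul]

lemma add {d : ℕ} {f g : ℕ → ℕ} (hf : BinomPos d f) (hg : BinomPos d g) :
    BinomPos d fun r => f r + g r := by
  obtain ⟨a, ha⟩ := hf
  obtain ⟨b, hb⟩ := hg
  exact ⟨fun k => a k + b k, fun r => by simp only [ha, hb, add_mul, sum_add_distrib]⟩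

lemma sum {d : ℕ} {ι : Type*} (s : Finset ι) {f : ι → ℕ → ℕ} (h : ∀ i ∈ s, BinomPos d (f i)) :
    BinomPos d fun r => ∑ i ∈ s, f i r := by
  classical
  induction s using Finset.induction_on with
  | empty => simpa using (const 0).mono (Nat.zero_le d)
  | insert i s hi ih =>
    simp only [sum_insert hi]
    exact (h i (mem_insert_self i s)).add (ih fun j hj => h j (mem_insert_of_mem hj))

lemma sum_range {d : ℕ} {f : ℕ → ℕ} (h : BinomPos d f) :
    BinomPos (d + 1) fun r => ∑ i ∈ range r, f i := by
  obtain ⟨a, ha⟩ := h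
  refine ⟨fun k => k.casesOn 0 a, fun r => ?_⟩
  rw [Finset.sum_range_succ']
  change _ = ∑ k ∈ range (d + 1), a k * r.choose (k + 1) + 0 * _
  simp only [ha, zero_mul, add_zero]
  rw [sum_comm]
  refine sum_congr rfl fun k _ => ?_
  rw [← mul_sum]
  congr 1
  induction r with
  | zero => simp
  | succ r ih => rw [Finset.sum_range_succ, ih, Nat.choose_succ_succ, add_comm]

end BinomPos

lemma cast_choose_mul_factorial (q d : ℕ) :
    (q.choose d : ℝ) * d.factorial = ∏ j ∈ range d, ((q : ℝ) - j) := by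
  induction d with
  | zero => simp
  | succ d ih =>
    have h : (q.choose (d + 1) : ℝ) * (d + 1) = q.choose d * (q - d) := by
      rcases le_or_gt d q with hd | hd
      · rw [← Nat.cast_sub hd]
        exact_mod_cast Nat.choose_succ_right_eq q d
      · simp [Nat.choose_eq_zero_of_lt hd, Nat.choose_eq_zero_of_lt (hd.trans (Nat.lt_succ_self d))]
    rw [prod_range_succ, ← ih, Nat.factorial_succ]
    push_cast
    linear_combination (d.factorial : ℝ) * h

/-- `f q` is the sum of `g |X| * ∏ j ∉ X, (q - j)` over the subsets `X` of `range d`. -/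
def SymmExpansion (d : ℕ) (g : ℕ → ℝ) (f : ℕ → ℝ) : Prop :=
  ∀ q, f q = ∑ X ∈ (range d).powerset, g #X * ∏ j ∈ range d \ X, ((q : ℝ) - j)

lemma SymmExpansion.shift {d : ℕ} {g f : ℕ → ℝ} (h : SymmExpansion d g f) :
    SymmExpansion d (fun l => ∑ i ∈ range (l + 1), l.choose i * g i) fun q => f (q + 1) := by
  intro q
  have key (X) (_ : X ∈ (range d).powerset) :
      g #X * ∏ j ∈ range d \ X, (((q + 1 : ℕ) : ℝ) - j) =
      ∑ Z ∈ (range d).powerset, if X ⊆ Z then g #X * ∏ j ∈ range d \ Z, ((q : ℝ) - j) else 0 := by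
    have h1 (j : ℕ) : ((q + 1 : ℕ) : ℝ) - j = 1 + (q - j) := by push_cast; ring
    simp_rw [h1, prod_add, prod_const_one, one_mul, mul_sum]
    rw [← sum_filter]
    refine sum_nbij' (fun Y => X ∪ Y) (fun Z => Z \ X) ?_ ?_ ?_ ?_ ?_
    · intro Y hY
      simp only [mem_powerset, mem_filter] at *
      grind
    · intro Y hY
      simp only [mem_powerset, mem_filter] at *
      grind
    · intro Y hY
      simp only [mem_powerset] at *
      grind
    · intro Y hY
      simp only [mem_powerset] at *
      grind
    · intro Y hY
      rw [sdiff_sdiff_left]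
      rfl
  change f (q + 1) = _
  rw [h, sum_congr rfl key, sum_comm]
  refine sum_congr rfl fun Z hZ => ?_
  rw [← sum_filter, ← sum_mul]
  congr 1
  have : {X ∈ (range d).powerset | X ⊆ Z} = Z.powerset := by
    ext X
    simp only [mem_filter, mem_powerset] at *
    exact ⟨fun h => h.2, fun h => ⟨h.trans hZ, h⟩⟩
  rw [this, sum_powerset_apply_card]
  simp [nsmul_eq_mul]

lemma exists_symmExpansion_choose {d : ℕ} (i : ℕ) (hi : i ≤ d) :
    ∃ g : ℕ → ℝ, (∀ k, 0 ≤ g k) ∧ SymmExpansion d g fun q => (q.choose (d - i) : ℝ) := by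
  induction i with
  | zero =>
    refine ⟨fun l => if l = 0 then (d.factorial : ℝ)⁻¹ else 0, fun k => by positivity, fun q => ?_⟩
    rw [sum_eq_single ∅]
    · simp only [card_empty, if_true, sdiff_empty, Nat.sub_zero]
      rw [← cast_choose_mul_factorial]
      field_simp
    · intro X _ hX
      simp [hX]
    · simp
  | succ i ih =>
    obtain ⟨g, hg, h⟩ := ih (by omega)
    refine ⟨fun l => ∑ i ∈ range l, l.choose i * g i,
      fun k => sum_nonneg fun i _ => mul_nonneg (by positivity) (hg i), fun q => ?_⟩
    have h1 := h.shift q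
    have h2 := h q
    simp only [sum_range_succ, Nat.choose_self, Nat.cast_one, one_mul, add_mul,
      sum_add_distrib] at h1
    rw [← h2, show d - i = d - (i + 1) + 1 by omega, Nat.choose_succ_succ] at h1
    push_cast at h1
    linarith

/-- A nonnegative combination of binomial coefficients has a nonnegative symmetric expansion. -/
lemma BinomPos.exists_eq_choose_mul_sum {d : ℕ} {f : ℕ → ℕ} (h : BinomPos d f) :
    ∃ g : ℕ → ℝ, (∀ k, 0 ≤ g k) ∧ ∀ q, d ≤ q → (f q : ℝ) =
      q.choose d * ∑ X ∈ (range d).powerset, g #X / ∏ j ∈ X, ((q : ℝ) - j) := by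
  obtain ⟨a, ha⟩ := h
  choose! G hG hE using fun i (hi : i ≤ d) => exists_symmExpansion_choose (d := d) i hi
  refine ⟨fun l => d.factorial * ∑ k ∈ range (d + 1), a k * G (d - k) l, fun l => ?_, fun q hq => ?_⟩
  · exact mul_nonneg (by positivity) <| sum_nonneg fun k _ =>
      mul_nonneg (by positivity) (hG _ (Nat.sub_le _ _) _)
  · have h1 (X) (hX : X ∈ (range d).powerset) :
        (q.choose d : ℝ) * ((d.factorial * ∑ k ∈ range (d + 1), a k * G (d - k) #X)
          / ∏ j ∈ X, ((q : ℝ) - j)) =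
        ∑ k ∈ range (d + 1), a k * (G (d - k) #X * ∏ j ∈ range d \ X, ((q : ℝ) - j)) := by
      have hne : ∏ j ∈ X, ((q : ℝ) - j) ≠ 0 := by
        refine prod_ne_zero_iff.2 fun j hj => ?_
        have := mem_range.1 (mem_powerset.1 hX hj)
        rw [sub_ne_zero]
        exact_mod_cast (by omega : q ≠ j)
      rw [← mul_div_assoc, ← mul_assoc, cast_choose_mul_factorial,
        ← prod_sdiff (mem_powerset.1 hX), div_eq_iff hne, mul_sum, sum_mul]
      exact sum_congr rfl fun k _ => by ring
    rw [mul_sum, sum_congr rfl h1, sum_comm, ha]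
    push_cast
    refine sum_congr rfl fun k hk => ?_
    have := hE (d - k) (Nat.sub_le _ _) q
    simp only [Nat.sub_sub_self (Nat.lt_succ_iff.1 (mem_range.1 hk))] at this
    rw [this, mul_sum]

section Cells

variable {E : Type*} [Fintype E] [DecidableEq E] {K : Submodule ℚ (E → ℚ)}

/-- The integer vectors of a rational subspace. -/
def intLattice (K : Submodule ℚ (E → ℚ)) : AddSubgroup (E → ℤ) :=
  K.toAddSubgroup.comap ((Int.castAddHom ℚ).compLeft E)

omit [Fintype E] [DecidableEq E] in
lemma mem_intLattice {x : E → ℤ} : x ∈ intLattice K ↔ (fun e => (x e : ℚ)) ∈ K := Iff.rfl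

open Classical in
/-- The integer points of the `r`-th dilate of the open cell `{y ∈ w + K | 0 < y < 1 on T, y = 0
off T}`. -/
noncomputable def cell (K : Submodule ℚ (E → ℚ)) (w : E → ℤ) (T : Finset E) (r : ℕ) :
    Finset (E → ℤ) :=
  {y ∈ Fintype.piFinset fun _ => Icc 0 (r : ℤ) | y - (r : ℤ) • w ∈ intLattice K ∧
    (∀ e ∈ T, 0 < y e ∧ y e < r) ∧ ∀ e ∉ T, y e = 0}

lemma mem_cell {w : E → ℤ} {T : Finset E} {r : ℕ} {y : E → ℤ} :
    y ∈ cell K w T r ↔ y - (r : ℤ) • w ∈ intLattice K ∧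
      (∀ e ∈ T, 0 < y e ∧ y e < r) ∧ ∀ e ∉ T, y e = 0 := by
  simp only [cell, mem_filter, Fintype.mem_piFinset, mem_Icc, and_iff_right_iff_imp]
  rintro ⟨-, h1, h2⟩ e
  by_cases he : e ∈ T
  · exact ⟨(h1 e he).1.le, (h1 e he).2.le⟩
  · simp [h2 e he]

/-- The vectors of `K` supported in `T`. -/
def supportedIn (K : Submodule ℚ (E → ℚ)) (T : Finset E) : Submodule ℚ (E → ℚ) where
  carrier := {z | z ∈ K ∧ ∀ e ∉ T, z e = 0}
  add_mem' := fun ha hb => ⟨K.add_mem ha.1 hb.1, fun e he => by simp [ha.2 e he, hb.2 e he]⟩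
  zero_mem' := ⟨K.zero_mem, fun _ _ => rfl⟩
  smul_mem' := fun c _ ha => ⟨K.smul_mem c ha.1, fun e he => by simp [ha.2 e he]⟩

omit [DecidableEq E] in
lemma finrank_supportedIn_lt {T T' : Finset E} (hT : T' ⊆ T) {z : E → ℤ} (hz : z ∈ intLattice K)
    (hzT : ∀ e ∉ T, z e = 0) {e : E} (he : e ∉ T') (hze : z e ≠ 0) :
    Module.finrank ℚ (supportedIn K T') < Module.finrank ℚ (supportedIn K T) := by
  refine Submodule.finrank_lt_finrank_of_lt (SetLike.lt_iff_le_and_exists.2 ⟨?_, ?_⟩)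
  · exact fun x hx => ⟨hx.1, fun e he => hx.2 e fun h => he (hT h)⟩
  · refine ⟨fun e => (z e : ℚ), ⟨hz, fun e he => by simp [hzT e he]⟩, fun h => hze ?_⟩
    simpa using h.2 e he

/-- Points of `[0,1]^E` congruent to an integer point modulo `K` can be rounded to a `0/1` vector
in the same class, without increasing the support. -/
def Rounds (K : Submodule ℚ (E → ℚ)) : Prop :=
  ∀ (y : E → ℚ) (w : E → ℤ), (∀ e, 0 ≤ y e ∧ y e ≤ 1) → (y - fun e => (w e : ℚ)) ∈ K →
    ∃ v : E → ℤ, (∀ e, v e = 0 ∨ v e = 1) ∧ v - w ∈ intLattice K ∧ ∀ e, y e = 0 → v e = 0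

lemma Rounds.exists_vertex (hK : Rounds K) {w : E → ℤ} {T : Finset E} {r : ℕ} {y : E → ℤ}
    (hy : y ∈ cell K w T (r + 1)) :
    ∃ v : E → ℤ, (∀ e, v e = 0 ∨ v e = 1) ∧ v - w ∈ intLattice K ∧ ∀ e ∉ T, v e = 0 := by
  obtain ⟨h1, h2, h3⟩ := mem_cell.1 hy
  have hr : (0 : ℚ) < (r : ℚ) + 1 := by positivity
  have hbox (e : E) : 0 ≤ (y e : ℚ) / (r + 1) ∧ (y e : ℚ) / (r + 1) ≤ 1 := by
    by_cases he : e ∈ T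
    · obtain ⟨ha, hb⟩ := h2 e he
      have ha' : (0 : ℚ) < y e := by exact_mod_cast ha
      have hb' : (y e : ℚ) < r + 1 := by exact_mod_cast hb
      exact ⟨by positivity, (div_le_one hr).2 hb'.le⟩
    · simp [h3 e he]
  have hmem : ((fun e => (y e : ℚ) / (r + 1)) - fun e => (w e : ℚ)) ∈ K := by
    convert K.smul_mem ((r : ℚ) + 1)⁻¹ (mem_intLattice.1 h1) using 1
    ext e
    simp
    field_simp
  obtain ⟨v, hv1, hv2, hv3⟩ := hK _ w hbox hmem
  exact ⟨v, hv1, hv2, fun e he => hv3 e (by simp [h3 e he])⟩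

/-- The coordinates in `T \ T'` that take the value `1` opposite to the vertex `v`. -/
def corner (v : E → ℤ) (T T' : Finset E) : E → ℤ :=
  fun e => if e ∈ T ∧ e ∉ T' ∧ v e = 0 then 1 else 0

/-- The embedding of a dilated boundary cell into the cell it spans with the vertex `v`. -/
def coneMap (v : E → ℤ) (T T' : Finset E) (r i : ℕ) (y : E → ℤ) : E → ℤ :=
  y + ((i : ℤ) + 1) • corner v T T' + ((r : ℤ) - i) • v

lemma coneMap_mem {v w : E → ℤ} {T T' : Finset E} {r i : ℕ} {y : E → ℤ}
    (hv : ∀ e, v e = 0 ∨ v e = 1) (hvw : v - w ∈ intLattice K) (hvT : ∀ e ∉ T, v e = 0)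
    (hT : T' ⊆ T) (hi : i < r) (hy : y ∈ cell K (w - corner v T T') T' (i + 1)) :
    coneMap v T T' r i y ∈ cell K w T (r + 1) := by
  obtain ⟨h1, h2, h3⟩ := mem_cell.1 hy
  refine mem_cell.2 ⟨?_, fun e he => ?_, fun e he => ?_⟩
  · convert add_mem h1 (zsmul_mem hvw ((r : ℤ) - i)) using 1
    ext e
    simp [coneMap]
    ring
  · by_cases he' : e ∈ T'
    · have := h2 e he'
      rcases hv e with h | h <;> simp [coneMap, corner, he', h] at this ⊢ <;> omega
    · have := h3 e he'
      rcases hv e with h | h <;> simp [coneMap, corner, he, he', h, this] <;> omega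
  · have := h3 e fun h => he (hT h)
    simp [coneMap, corner, he, this, hvT e he]

lemma exists_coneMap_eq {v w : E → ℤ} {T : Finset E} {r : ℕ} {x : E → ℤ}
    (hv : ∀ e, v e = 0 ∨ v e = 1) (hvw : v - w ∈ intLattice K) (hvT : ∀ e ∉ T, v e = 0)
    (hne : T.Nonempty) (hx : x ∈ cell K w T (r + 1)) :
    ∃ T' ⊂ T, ∃ i < r, ∃ y ∈ cell K (w - corner v T T') T' (i + 1), coneMap v T T' r i y = x := by
  obtain ⟨h1, h2, h3⟩ := mem_cell.1 hx
  obtain ⟨e₀, he₀, hmin⟩ := T.exists_min_image (fun e => if v e = 0 then (r : ℤ) + 1 - x e else x e) hne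
  obtain ⟨i, hi⟩ : ∃ i : ℕ, (i : ℤ) = r - if v e₀ = 0 then (r : ℤ) + 1 - x e₀ else x e₀ := by
    refine ⟨_, Int.toNat_of_nonneg ?_⟩
    have := h2 e₀ he₀
    push_cast at this
    split_ifs <;> omega
  have hir : i < r := by
    have := h2 e₀ he₀
    push_cast at this
    split_ifs at hi <;> omega
  set T' : Finset E := {e ∈ T | (r : ℤ) - i < if v e = 0 then (r : ℤ) + 1 - x e else x e}
  have hsub : T' ⊆ T := filter_subset _ _
  refine ⟨T', ⟨hsub, fun h => ?_⟩, i, hir,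
    x - ((i : ℤ) + 1) • corner v T T' - ((r : ℤ) - i) • v, ?_, ?_⟩
  · have := (mem_filter.1 (h he₀)).2
    omega
  · refine mem_cell.2 ⟨?_, fun e he => ?_, fun e he => ?_⟩
    · convert sub_mem h1 (zsmul_mem hvw ((r : ℤ) - i)) using 1
      ext e
      simp
      ring
    · have := (mem_filter.1 he).2
      have h4 := h2 e (hsub he)
      push_cast at h4
      rcases hv e with h | h <;> simp [h, corner, he] at this ⊢ <;> omega
    · by_cases heT : e ∈ T
      · have h4 := hmin e heT
        have h5 : ¬ ((r : ℤ) - i < if v e = 0 then (r : ℤ) + 1 - x e else x e) :=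
          fun h => he (mem_filter.2 ⟨heT, h⟩)
        rcases hv e with h | h <;> simp [h, corner, he, heT] at h4 h5 ⊢ <;> omega
      · simp [corner, heT, h3 e heT, hvT e heT]
  · rw [coneMap]
    abel

lemma le_of_coneMap_eq {v w w' : E → ℤ} {T T' T'' : Finset E} {r i i' : ℕ} {y y' : E → ℤ}
    (hv : ∀ e, v e = 0 ∨ v e = 1) (hT' : T' ⊂ T)
    (hy : y ∈ cell K w T' (i + 1)) (hy' : y' ∈ cell K w' T'' (i' + 1))
    (h : coneMap v T T' r i y = coneMap v T T'' r i' y') : i ≤ i' := by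
  obtain ⟨e, heT, he⟩ := exists_of_ssubset hT'
  have h1 := (mem_cell.1 hy).2.2 e he
  have h2 := (mem_cell.1 hy').2
  have h3 := congrFun h e
  by_cases he' : e ∈ T''
  · have := h2.1 e he'
    rcases hv e with h | h <;> simp [coneMap, corner, heT, he, he', h, h1] at h3 this <;> omega
  · have := h2.2 e he'
    rcases hv e with h | h <;> simp [coneMap, corner, heT, he, he', h, h1, this] at h3 <;> omega

lemma eq_of_coneMap_eq {v w w' : E → ℤ} {T T' T'' : Finset E} {r i i' : ℕ} {y y' : E → ℤ}
    (hv : ∀ e, v e = 0 ∨ v e = 1) (hT' : T' ⊂ T) (hT'' : T'' ⊂ T)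
    (hy : y ∈ cell K w T' (i + 1)) (hy' : y' ∈ cell K w' T'' (i' + 1))
    (h : coneMap v T T' r i y = coneMap v T T'' r i' y') : T' = T'' ∧ i = i' := by
  have hi := (le_of_coneMap_eq hv hT' hy hy' h).antisymm
    (le_of_coneMap_eq hv hT'' hy' hy h.symm)
  subst hi
  refine ⟨?_, rfl⟩
  obtain ⟨-, h1, h2⟩ := mem_cell.1 hy
  obtain ⟨-, h1', h2'⟩ := mem_cell.1 hy'
  ext e
  have h3 := congrFun h e
  by_cases he : e ∈ T' <;> by_cases he' : e ∈ T''
  · simp [he, he']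
  · have h4 := h1 e he
    push_cast at h4
    rcases hv e with h | h <;>
      simp [coneMap, corner, he, he', hT'.1 he, h2' e he', h] at h3 <;> omega
  · have h4 := h1' e he'
    push_cast at h4
    rcases hv e with h | h <;>
      simp [coneMap, corner, he, he', hT''.1 he', h2 e he, h] at h3 <;> omega
  · simp [he, he']

lemma card_cell_succ {v w : E → ℤ} {T : Finset E} (hv : ∀ e, v e = 0 ∨ v e = 1)
    (hvw : v - w ∈ intLattice K) (hvT : ∀ e ∉ T, v e = 0) (hne : T.Nonempty) (r : ℕ) :
    #(cell K w T (r + 1)) =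
      ∑ T' ∈ T.ssubsets, ∑ i ∈ range r, #(cell K (w - corner v T T') T' (i + 1)) := by
  have h : cell K w T (r + 1) = (T.ssubsets ×ˢ range r).biUnion fun p =>
      (cell K (w - corner v T p.1) p.1 (p.2 + 1)).image (coneMap v T p.1 r p.2) := by
    ext x
    simp only [mem_biUnion, mem_product, mem_ssubsets, mem_range, mem_image, Prod.exists]
    constructor
    · intro hx
      obtain ⟨T', hT', i, hi, y, hy, rfl⟩ := exists_coneMap_eq hv hvw hvT hne hx
      exact ⟨T', i, ⟨hT', hi⟩, y, hy, rfl⟩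
    · rintro ⟨T', i, ⟨hT', hi⟩, y, hy, rfl⟩
      exact coneMap_mem hv hvw hvT hT'.1 hi hy
  rw [h, card_biUnion, sum_product]
  · refine sum_congr rfl fun T' _ => sum_congr rfl fun i _ => card_image_of_injective _ fun y y' hy => ?_
    simpa [coneMap] using hy
  · rintro ⟨T', i⟩ hp ⟨T'', i'⟩ hp' hne
    simp only [coe_product, Set.mem_prod, mem_coe, mem_ssubsets] at hp hp'
    refine disjoint_left.2 fun x hx hx' => hne ?_
    obtain ⟨y, hy, rfl⟩ := mem_image.1 hx
    obtain ⟨y', hy', h⟩ := mem_image.1 hx'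
    obtain ⟨rfl, rfl⟩ := eq_of_coneMap_eq hv hp.1 hp'.1 hy hy' h.symm
    rfl

/-- The counting function of an open cell is a nonnegative combination of the `(r - 1).choose k`
with `k` at most the dimension of the cell. -/
lemma Rounds.binomPos_card_cell (hK : Rounds K) (T : Finset E) (w : E → ℤ) :
    BinomPos (Module.finrank ℚ (supportedIn K T)) fun r => #(cell K w T (r + 1)) := by
  induction T using Finset.strongInduction generalizing w with
  | H T ih =>
  by_cases hempty : ∀ r, cell K w T (r + 1) = ∅
  · simpa [hempty] using (BinomPos.const 0).mono (Nat.zero_le _)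
  push Not at hempty
  obtain ⟨r₀, y₀, hy₀⟩ := hempty
  obtain ⟨v, hv, hvw, hvT⟩ := hK.exists_vertex hy₀
  obtain rfl | hne := T.eq_empty_or_nonempty
  · have hv0 : v = 0 := funext fun e => hvT e (notMem_empty e)
    have (r : ℕ) : cell K w ∅ (r + 1) = {0} := by
      ext y
      simp only [mem_cell, notMem_empty, IsEmpty.forall_iff, implies_true, not_false_eq_true,
        forall_const, true_and, mem_singleton]
      refine ⟨fun h => funext h.2, ?_⟩
      rintro rfl
      refine ⟨?_, fun _ => rfl⟩
      rw [hv0] at hvw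
      convert zsmul_mem hvw ((r + 1 : ℕ) : ℤ) using 1
      simp
    simpa [this] using (BinomPos.const 1).mono (Nat.zero_le _)
  · simp only [card_cell_succ hv hvw hvT hne]
    refine BinomPos.sum _ fun T' hT' => ?_
    rw [mem_ssubsets] at hT'
    by_cases hempty : ∀ r, cell K (w - corner v T T') T' (r + 1) = ∅
    · simpa [hempty] using (BinomPos.const 0).mono (Nat.zero_le _)
    push Not at hempty
    obtain ⟨r, y, hy⟩ := hempty
    obtain ⟨h1, h2, h3⟩ := mem_cell.1 hy
    obtain ⟨e, heT, he⟩ := exists_of_ssubset hT'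
    refine (ih T' hT' (w - corner v T T')).sum_range.mono (finrank_supportedIn_lt (e := e)
      (z := y + ((r : ℤ) + 1) • corner v T T' - ((r : ℤ) + 1) • v) hT'.1 ?_ ?_ he ?_)
    · convert sub_mem h1 (zsmul_mem hvw ((r : ℤ) + 1)) using 1
      ext e
      simp
      ring
    · intro e he
      simp [corner, he, hvT e he, h3 e fun h => he (hT'.1 h)]
    · rcases hv e with h | h <;> simp [corner, heT, he, h, h3 e he] <;> omega

/-- The nonnegative integer points of `r • v + K` with coordinates at most `s * r`. -/
noncomputable def dilatePoints (K : Submodule ℚ (E → ℚ)) (v : E → ℤ) (s r : ℕ) :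
    Finset (E → ℤ) := by
  classical
  exact {x ∈ Fintype.piFinset fun _ => Icc 0 ((s : ℤ) * r) | x - (r : ℤ) • v ∈ intLattice K}

/-- The points of `dilatePoints` that vanish somewhere on the support of `v`. -/
noncomputable def boundaryPoints (K : Submodule ℚ (E → ℚ)) (v : E → ℤ) (s r : ℕ) : Finset (E → ℤ) :=
  {x ∈ dilatePoints K v s r | ∃ e, v e = 1 ∧ x e = 0}

/-- Every dilate of `(v + K) ∩ ℝ≥0^E` is bounded, linearly in the dilation factor. -/
def DilatesBounded (K : Submodule ℚ (E → ℚ)) (v : E → ℤ) (s : ℕ) : Prop :=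
  ∀ (r : ℕ) (x : E → ℤ), (∀ e, 0 ≤ x e) → x - (r : ℤ) • v ∈ intLattice K → ∀ e, x e ≤ s * r

lemma mem_dilatePoints {v : E → ℤ} {s r : ℕ} {x : E → ℤ} (hs : DilatesBounded K v s) :
    x ∈ dilatePoints K v s r ↔ (∀ e, 0 ≤ x e) ∧ x - (r : ℤ) • v ∈ intLattice K := by
  simp only [dilatePoints, mem_filter, Fintype.mem_piFinset, mem_Icc]
  exact ⟨fun h => ⟨fun e => (h.1 e).1, h.2⟩, fun h => ⟨fun e => ⟨h.1 e, hs r x h.1 h.2 e⟩, h.2⟩⟩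

lemma mem_boundaryPoints {v : E → ℤ} {s r : ℕ} {x : E → ℤ} (hs : DilatesBounded K v s) :
    x ∈ boundaryPoints K v s r ↔ (∀ e, 0 ≤ x e) ∧ x - (r : ℤ) • v ∈ intLattice K ∧
      ∃ e, v e = 1 ∧ x e = 0 := by
  rw [boundaryPoints, mem_filter, mem_dilatePoints hs, and_assoc]

lemma card_dilatePoints {v : E → ℤ} {s : ℕ} (hv : ∀ e, v e = 0 ∨ v e = 1) (hv0 : ∃ e, v e = 1)
    (hs : DilatesBounded K v s) (q : ℕ) :
    #(dilatePoints K v s q) = ∑ i ∈ range (q + 1), #(boundaryPoints K v s i) := by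
  have h : dilatePoints K v s q = (range (q + 1)).biUnion fun i =>
      (boundaryPoints K v s i).image fun y => y + ((q : ℤ) - i) • v := by
    ext x
    simp only [mem_biUnion, mem_range, mem_image, mem_boundaryPoints hs, mem_dilatePoints hs]
    constructor
    · rintro ⟨h1, h2⟩
      obtain ⟨e₀, he₀, hmin⟩ := ({e | v e = 1} : Finset E).exists_min_image x
        (by simpa [Finset.Nonempty] using hv0)
      replace he₀ : v e₀ = 1 := by simpa using he₀
      have hpos (e : E) : 0 ≤ x e - x e₀ * v e := by
        rcases hv e with h | h
        · simpa [h] using h1 e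
        · simpa [h] using hmin e (by simpa using h)
      have hle : x e₀ ≤ q := by
        by_contra! hlt
        have := hs 0 (x - (q : ℤ) • v) (fun e => ?_) (by simpa using h2) e₀
        · simp [he₀] at this
          omega
        · have := hpos e
          rcases hv e with h | h <;> simp [h] at this ⊢ <;> omega
      obtain ⟨i, hi⟩ : ∃ i : ℕ, (i : ℤ) = q - x e₀ := ⟨_, Int.toNat_of_nonneg (by omega)⟩
      refine ⟨i, by have := h1 e₀; omega, x - (x e₀) • v, ⟨hpos, ?_, e₀, he₀, by simp [he₀]⟩, ?_⟩
      · convert h2 using 1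
        rw [hi]
        module
      · rw [hi]
        module
    · rintro ⟨i, hi, y, ⟨h1, h2, -⟩, rfl⟩
      refine ⟨fun e => ?_, ?_⟩
      · have := h1 e
        rcases hv e with h | h <;> simp [h] <;> omega
      · convert h2 using 1
        module
  have hle {i i' : ℕ} {y y' : E → ℤ} (hy : y ∈ boundaryPoints K v s i)
      (hy' : y' ∈ boundaryPoints K v s i') (h : y + ((q : ℤ) - i) • v = y' + ((q : ℤ) - i') • v) :
      i ≤ i' := by
    obtain ⟨-, -, e, he, he'⟩ := (mem_boundaryPoints hs).1 hy
    have h1 := ((mem_boundaryPoints hs).1 hy').1 e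
    have h2 := congrFun h e
    simp [he, he'] at h2
    omega
  rw [h, card_biUnion]
  · refine sum_congr rfl fun i _ => card_image_of_injective _ fun y y' hy => ?_
    simpa using hy
  · intro i _ i' _ hne
    refine disjoint_left.2 fun x hx hx' => hne ?_
    obtain ⟨y, hy, rfl⟩ := mem_image.1 hx
    obtain ⟨y', hy', h⟩ := mem_image.1 hx'
    exact (hle hy hy' h.symm).antisymm (hle hy' hy h)

/-- The open unit cells, given by their lower corner and set of free coordinates, that tile the
part of the boundary opposite to `v`. -/
noncomputable def boundaryCells (v : E → ℤ) (s : ℕ) : Finset ((E → ℤ) × Finset E) :=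
  {p ∈ (Fintype.piFinset fun _ => Icc 0 (s : ℤ)) ×ˢ univ | ∃ e, v e = 1 ∧ p.1 e = 0 ∧ e ∉ p.2}

lemma card_boundaryPoints_succ {v : E → ℤ} {s : ℕ} (hs : DilatesBounded K v s) (r : ℕ) :
    #(boundaryPoints K v s (r + 1)) = ∑ p ∈ boundaryCells v s, #(cell K (v - p.1) p.2 (r + 1)) := by
  have h : boundaryPoints K v s (r + 1) = (boundaryCells v s).biUnion fun p =>
      (cell K (v - p.1) p.2 (r + 1)).image fun y => y + ((r : ℤ) + 1) • p.1 := by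
    ext x
    simp only [mem_biUnion, mem_image, mem_boundaryPoints hs, mem_cell, boundaryCells, mem_filter,
      mem_product, Fintype.mem_piFinset, mem_Icc, mem_univ, and_true, Prod.exists]
    have hr : (0 : ℤ) < (r : ℤ) + 1 := by positivity
    constructor
    · rintro ⟨h1, h2, e₀, he₀, hx₀⟩
      refine ⟨fun e => x e / (r + 1), ({e | x e % (r + 1) ≠ 0} : Finset E),
        ⟨fun e => ⟨Int.ediv_nonneg (h1 e) hr.le, ?_⟩, e₀, he₀, by simp [hx₀], by simp [hx₀]⟩,
        fun e => x e % (r + 1), ⟨?_, fun e he => ?_, fun e he => ?_⟩, ?_⟩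
      · refine Int.ediv_le_of_le_mul hr ?_
        simpa using hs (r + 1) x h1 h2 e
      · convert h2 using 1
        ext e
        have := Int.emod_add_mul_ediv (x e) (r + 1)
        simp
        linarith
      · have h4 := Int.emod_nonneg (x e) hr.ne'
        have h5 := Int.emod_lt_of_pos (x e) hr
        have h6 : x e % (r + 1) ≠ 0 := by simpa using he
        push_cast
        omega
      · simpa using he
      · ext e
        simpa using Int.emod_add_mul_ediv (x e) (r + 1)
    · rintro ⟨k, T, ⟨hk, e₀, he₀, hk₀, hT₀⟩, y, ⟨h1, h2, h3⟩, rfl⟩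
      refine ⟨fun e => ?_, ?_, e₀, he₀, by simp [h3 e₀ hT₀, hk₀]⟩
      · have h4 : 0 ≤ y e := by
          by_cases he : e ∈ T
          · exact (h2 e he).1.le
          · exact (h3 e he).ge
        have := mul_nonneg hr.le (hk e).1
        simp
        omega
      · convert h1 using 1
        push_cast
        module
  rw [h, card_biUnion]
  · refine sum_congr rfl fun i _ => card_image_of_injective _ fun y y' hy => ?_
    simpa using hy
  · rintro ⟨k, T⟩ _ ⟨k', T'⟩ _ hne
    refine disjoint_left.2 fun x hx hx' => hne ?_
    obtain ⟨y, hy, rfl⟩ := mem_image.1 hx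
    obtain ⟨y', hy', h⟩ := mem_image.1 hx'
    have hbd {k : E → ℤ} {T : Finset E} {y : E → ℤ} (hy : y ∈ cell K (v - k) T (r + 1)) (e : E) :
        0 ≤ y e ∧ y e < (r : ℤ) + 1 ∧ (e ∈ T ↔ y e ≠ 0) := by
      obtain ⟨-, h1, h2⟩ := mem_cell.1 hy
      by_cases he : e ∈ T
      · have := h1 e he
        push_cast at this
        exact ⟨this.1.le, this.2, by simp [he, this.1.ne']⟩
      · simp [h2 e he, he]
    have hmod {k : E → ℤ} {T : Finset E} {y : E → ℤ} (hy : y ∈ cell K (v - k) T (r + 1)) (e : E) :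
        (y + ((r : ℤ) + 1) • k) e % (r + 1) = y e ∧ (y + ((r : ℤ) + 1) • k) e / (r + 1) = k e := by
      obtain ⟨h1, h2, -⟩ := hbd hy e
      refine ⟨by simpa using Int.emod_eq_of_lt h1 h2, ?_⟩
      simp [Int.add_mul_ediv_left _ _ (by positivity : (r : ℤ) + 1 ≠ 0), Int.ediv_eq_zero_of_lt h1 h2]
    have hyy (e : E) : y e = y' e := by rw [← (hmod hy e).1, ← (hmod hy' e).1, h]
    refine Prod.ext (funext fun e => ?_) (Finset.ext fun e => ?_)
    · exact (hmod hy e).2.symm.trans ((by rw [h]) : _ = _) |>.trans (hmod hy' e).2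
    · rw [(hbd hy e).2.2, (hbd hy' e).2.2, hyy]

/-- If `v + K` contains a `0/1` point `v`, the Ehrhart function of `(v + K) ∩ ℝ≥0^E` is a
nonnegative combination of the `q.choose k` with `k ≤ dim K`. -/
lemma Rounds.binomPos_card_dilatePoints (hK : Rounds K) {v : E → ℤ} {s : ℕ}
    (hv : ∀ e, v e = 0 ∨ v e = 1) (hv0 : ∃ e, v e = 1) (hs : DilatesBounded K v s) :
    BinomPos (Module.finrank ℚ K) fun q => #(dilatePoints K v s q) := by
  have htop : supportedIn K univ = K := by
    ext z
    exact ⟨fun h => h.1, fun h => ⟨h, fun e he => absurd (mem_univ e) he⟩⟩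
  simp only [card_dilatePoints hv hv0 hs, Finset.sum_range_succ']
  refine BinomPos.add ?_ ((BinomPos.const _).mono (Nat.zero_le _))
  simp only [card_boundaryPoints_succ hs]
  simp only [sum_comm (s := range _)]
  refine BinomPos.sum _ fun p hp => ?_
  obtain ⟨e, he, hpe, heT⟩ := (mem_filter.1 hp).2
  by_cases hempty : ∀ r, cell K (v - p.1) p.2 (r + 1) = ∅
  · simpa [hempty] using (BinomPos.const 0).mono (Nat.zero_le _)
  push Not at hempty
  obtain ⟨r, y, hy⟩ := hempty
  obtain ⟨h1, h2, h3⟩ := mem_cell.1 hy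
  refine (hK.binomPos_card_cell p.2 (v - p.1)).sum_range.mono ?_
  conv_rhs => rw [← htop]
  refine finrank_supportedIn_lt (z := y - ((r + 1 : ℕ) : ℤ) • (v - p.1)) (subset_univ _) h1
    (fun e he => absurd (mem_univ e) he) heT ?_
  simp [h3 e heT, he, hpe]
  omega

end Cells

section ZeroMargins

variable {α β : Type*} [Fintype α] [Fintype β]

/-- The rational matrices all of whose row and column sums vanish. -/
def zeroMargins (α β : Type*) [Fintype α] [Fintype β] : Submodule ℚ (α × β → ℚ) where
  carrier := {z | (∀ i, ∑ j, z (i, j) = 0) ∧ ∀ j, ∑ i, z (i, j) = 0}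
  add_mem' := fun ha hb => by
    refine ⟨fun i => ?_, fun j => ?_⟩
    · simp [sum_add_distrib, ha.1 i, hb.1 i]
    · simp [sum_add_distrib, ha.2 j, hb.2 j]
  zero_mem' := by simp
  smul_mem' := fun c _ ha => by
    refine ⟨fun i => ?_, fun j => ?_⟩
    · simp [← mul_sum, ha.1 i]
    · simp [← mul_sum, ha.2 j]

lemma mem_zeroMargins {z : α × β → ℚ} :
    z ∈ zeroMargins α β ↔ (∀ i, ∑ j, z (i, j) = 0) ∧ ∀ j, ∑ i, z (i, j) = 0 := Iff.rfl

variable [DecidableEq α] [DecidableEq β]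

/-- A nonempty set of positions meeting each row and each column either never or at least twice
supports a nonzero matrix with zero margins. -/
lemma exists_zeroMargins_supported {F : Finset (α × β)} (hne : F.Nonempty)
    (hrow : ∀ e ∈ F, ∃ e' ∈ F, e'.1 = e.1 ∧ e' ≠ e)
    (hcol : ∀ e ∈ F, ∃ e' ∈ F, e'.2 = e.2 ∧ e' ≠ e) :
    ∃ z ∈ zeroMargins α β, z ≠ 0 ∧ ∀ e ∉ F, z e = 0 := by
  obtain ⟨⟨i₀, j₀⟩, h₀⟩ := hne
  let ext : (F → ℚ) →ₗ[ℚ] (α × β → ℚ) := Function.ExtendByZero.linearMap ℚ (Subtype.val : F → α × β)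
  have hext (z : F → ℚ) (e : α × β) (he : e ∉ F) : ext z e = 0 :=
    Function.extend_apply' _ _ _ fun ⟨a, ha⟩ => he (ha ▸ a.2)
  have hext' (z : F → ℚ) (e : F) : ext z e = z e := Subtype.val_injective.extend_apply _ _ _
  let φ : (F → ℚ) →ₗ[ℚ] (((F.image Prod.fst).erase i₀ → ℚ) × (F.image Prod.snd → ℚ)) :=
    (LinearMap.pi fun i : (F.image Prod.fst).erase i₀ => ∑ j : β, LinearMap.proj ((i : α), j) ∘ₗ ext).prod
      (LinearMap.pi fun j : F.image Prod.snd => ∑ i : α, LinearMap.proj (i, (j : β)) ∘ₗ ext)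
  have hcard : #((F.image Prod.fst).erase i₀) + #(F.image Prod.snd) < #F := by
    have h1 : 2 * #(F.image Prod.fst) ≤ #F := by
      refine mul_card_image_le_card F 2 fun i hi => ?_
      obtain ⟨e, he, rfl⟩ := mem_image.1 hi
      obtain ⟨e', he', h, hne⟩ := hrow e he
      exact one_lt_card.2 ⟨e', mem_filter.2 ⟨he', h⟩, e, mem_filter.2 ⟨he, rfl⟩, hne⟩
    have h2 : 2 * #(F.image Prod.snd) ≤ #F := by
      refine mul_card_image_le_card F 2 fun i hi => ?_
      obtain ⟨e, he, rfl⟩ := mem_image.1 hi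
      obtain ⟨e', he', h, hne⟩ := hcol e he
      exact one_lt_card.2 ⟨e', mem_filter.2 ⟨he', h⟩, e, mem_filter.2 ⟨he, rfl⟩, hne⟩
    have h3 : i₀ ∈ F.image Prod.fst := mem_image.2 ⟨_, h₀, rfl⟩
    have := card_erase_add_one h3
    omega
  obtain ⟨z, hz, hz0⟩ := (Submodule.ne_bot_iff _).1 <|
    LinearMap.ker_ne_bot_of_finrank_lt (f := φ) (by
      simpa only [Module.finrank_prod, Module.finrank_fintype_fun_eq_card, Fintype.card_coe]
        using hcard)
  have hφ := LinearMap.mem_ker.1 hz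
  have hc (j : β) : ∑ i, ext z (i, j) = 0 := by
    by_cases hj : j ∈ F.image Prod.snd
    · simpa [φ] using congrFun (congrArg Prod.snd hφ) ⟨j, hj⟩
    · exact sum_eq_zero fun i _ => hext z _ fun h => hj (mem_image.2 ⟨_, h, rfl⟩)
  have hr (i : α) (hi : i ≠ i₀) : ∑ j, ext z (i, j) = 0 := by
    by_cases hi' : i ∈ F.image Prod.fst
    · simpa [φ] using congrFun (congrArg Prod.fst hφ) ⟨i, mem_erase.2 ⟨hi, hi'⟩⟩
    · exact sum_eq_zero fun j _ => hext z _ fun h => hi' (mem_image.2 ⟨_, h, rfl⟩)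
  refine ⟨ext z, ⟨fun i => ?_, hc⟩, fun h => hz0 (funext fun e => ?_), hext z⟩
  · by_cases hi : i = i₀
    · subst hi
      have h1 : ∑ i, ∑ j, ext z (i, j) = 0 := by rw [sum_comm]; simp [hc]
      rwa [sum_eq_single i (fun i' _ h => hr i' h) (by simp)] at h1
    · exact hr i hi
  · exact (hext' z e).symm.trans (congrFun h _)

/-- Moving along a direction supported on fractional coordinates until one becomes integral. -/
lemma exists_smul_add_card_lt {E : Type*} [Fintype E] {y z : E → ℚ}
    (hy : ∀ e, 0 ≤ y e ∧ y e ≤ 1) (hz : z ≠ 0) (hzF : ∀ e, y e = 0 ∨ y e = 1 → z e = 0) :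
    ∃ t : ℚ, (∀ e, 0 ≤ y e + t * z e ∧ y e + t * z e ≤ 1) ∧
      #{e | ¬(y e + t * z e = 0 ∨ y e + t * z e = 1)} < #{e | ¬(y e = 0 ∨ y e = 1)} := by
  obtain ⟨e₁, he₁⟩ := Function.ne_iff.1 hz
  obtain ⟨e₀, he₀, hmin⟩ := ({e | z e ≠ 0} : Finset E).exists_min_image
    (fun e => if 0 < z e then (1 - y e) / z e else y e / (-z e)) ⟨e₁, by simpa using he₁⟩
  replace he₀ : z e₀ ≠ 0 := by simpa using he₀
  refine ⟨if 0 < z e₀ then (1 - y e₀) / z e₀ else y e₀ / (-z e₀), ?_, ?_⟩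
  · intro e
    set t : ℚ := if 0 < z e₀ then (1 - y e₀) / z e₀ else y e₀ / (-z e₀)
    have ht : 0 ≤ t := by
      simp only [t]
      split_ifs with h
      · exact div_nonneg (by linarith [(hy e₀).2]) h.le
      · exact div_nonneg (hy e₀).1 (by linarith)
    obtain ⟨h0, h1⟩ := hy e
    rcases lt_trichotomy (z e) 0 with h | h | h
    · have h2 := hmin e (by simpa using h.ne)
      rw [if_neg h.not_gt, le_div_iff₀ (by linarith)] at h2
      constructor <;> nlinarith
    · simp [h, h0, h1]
    · have h2 := hmin e (by simpa using h.ne')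
      rw [if_pos h, le_div_iff₀ h] at h2
      constructor <;> nlinarith
  · refine card_lt_card (ssubset_iff_of_subset ?_ |>.2 ⟨e₀, ?_, ?_⟩)
    · intro e
      simp only [mem_filter, mem_univ, true_and]
      intro h h'
      rw [hzF e h', mul_zero, add_zero] at h
      exact h h'
    · simpa using fun h => he₀ (hzF e₀ h)
    · simp only [mem_filter, mem_univ, true_and, not_not]
      split_ifs with h
      · right
        field_simp
        ring
      · left
        field_simp
        ring

/-- If a sum of numbers in `[0, 1]` is an integer and one of them is not an integer, then so is
another one. -/
lemma exists_ne_fractional {ι : Type*} [Fintype ι] [DecidableEq ι] {f : ι → ℚ} {c : ℤ}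
    (hf : ∀ i, 0 ≤ f i ∧ f i ≤ 1) (hc : ∑ i, f i = c) {i : ι} (hi : ¬(f i = 0 ∨ f i = 1)) :
    ∃ i', i' ≠ i ∧ ¬(f i' = 0 ∨ f i' = 1) := by
  by_contra! h
  have h1 (i' : ι) (hi' : i' ∈ univ.erase i) : f i' = ((if f i' = 1 then 1 else 0 : ℤ) : ℚ) := by
    rcases h i' (ne_of_mem_erase hi') with h | h <;> simp [h]
  rw [← add_sum_erase _ _ (mem_univ i), sum_congr rfl h1, ← Int.cast_sum, ← eq_sub_iff_add_eq,
    ← Int.cast_sub] at hc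
  generalize c - _ = k at hc
  obtain ⟨h2, h3⟩ := hf i
  rw [hc] at h2 h3 hi
  have h2' : 0 ≤ k := by exact_mod_cast h2
  have h3' : k ≤ 1 := by exact_mod_cast h3
  apply hi
  interval_cases k <;> simp

lemma rounds_zeroMargins : Rounds (zeroMargins α β) := by
  intro y w hy hyw
  induction hN : #{e | ¬(y e = 0 ∨ y e = 1)} using Nat.strong_induction_on generalizing y with
  | _ N ih =>
  subst hN
  obtain hF | hne := ({e | ¬(y e = 0 ∨ y e = 1)} : Finset (α × β)).eq_empty_or_nonempty
  · have hint (e : α × β) : y e = 0 ∨ y e = 1 := by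
      by_contra h
      exact notMem_empty e (hF ▸ mem_filter.2 ⟨mem_univ e, h⟩)
    refine ⟨fun e => if y e = 1 then 1 else 0, fun e => ?_, ?_, fun e he => by simp [he]⟩
    · rcases hint e with h | h <;> simp [h]
    · rw [mem_intLattice]
      convert hyw using 1
      ext e
      rcases hint e with h | h <;> simp [h]
  · obtain ⟨hr, hc⟩ := mem_zeroMargins.1 hyw
    obtain ⟨z, hzK, hz0, hzF⟩ := exists_zeroMargins_supported hne
      (by
        rintro ⟨i, j⟩ he
        have hsum : ∑ j, y (i, j) = ((∑ j, w (i, j) : ℤ) : ℚ) := by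
          have := hr i
          simp only [Pi.sub_apply, sum_sub_distrib, sub_eq_zero] at this
          exact_mod_cast this
        obtain ⟨j', hj', h⟩ := exists_ne_fractional (fun j => hy (i, j)) hsum (mem_filter.1 he).2
        exact ⟨(i, j'), mem_filter.2 ⟨mem_univ _, h⟩, rfl, by simpa using hj'⟩)
      (by
        rintro ⟨i, j⟩ he
        have hsum : ∑ i, y (i, j) = ((∑ i, w (i, j) : ℤ) : ℚ) := by
          have := hc j
          simp only [Pi.sub_apply, sum_sub_distrib, sub_eq_zero] at this
          exact_mod_cast this
        obtain ⟨i', hi', h⟩ := exists_ne_fractional (fun i => hy (i, j)) hsum (mem_filter.1 he).2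
        exact ⟨(i', j), mem_filter.2 ⟨mem_univ _, h⟩, rfl, by simpa using hi'⟩)
    have hzF' (e : α × β) (h : y e = 0 ∨ y e = 1) : z e = 0 := hzF e fun he => (mem_filter.1 he).2 h
    obtain ⟨t, ht, hlt⟩ := exists_smul_add_card_lt hy hz0 hzF'
    obtain ⟨v, hv, hvw, hv0⟩ := ih _ hlt (fun e => y e + t * z e) ht
      (by
        convert add_mem hyw (Submodule.smul_mem _ t hzK) using 1
        ext e
        simp
        ring) rfl
    exact ⟨v, hv, hvw, fun e he => hv0 e (by simp [he, hzF' e (Or.inl he)])⟩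

lemma finrank_zeroMargins_le (m n : ℕ) :
    Module.finrank ℚ (zeroMargins (Fin (m + 1)) (Fin (n + 1))) ≤ m * n := by
  let φ : zeroMargins (Fin (m + 1)) (Fin (n + 1)) →ₗ[ℚ] (Fin m × Fin n → ℚ) :=
    (LinearMap.pi fun p => LinearMap.proj (p.1.succ, p.2.succ)) ∘ₗ Submodule.subtype _
  have hφ : Function.Injective φ := by
    rw [← LinearMap.ker_eq_bot, Submodule.eq_bot_iff]
    rintro ⟨z, hr, hc⟩ h
    have h1 (i : Fin m) (j : Fin n) : z (i.succ, j.succ) = 0 :=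
      congrFun (LinearMap.mem_ker.1 h) (i, j)
    have h2 (i : Fin m) : z (i.succ, 0) = 0 := by simpa [Fin.sum_univ_succ, h1] using hr i.succ
    have h3 (j : Fin (n + 1)) : z (0, j) = 0 := by
      have := hc j
      rw [Fin.sum_univ_succ] at this
      cases j using Fin.cases with
      | zero => simpa [h2] using this
      | succ j => simpa [h1] using this
    ext ⟨i, j⟩
    cases i using Fin.cases with
    | zero => exact h3 j
    | succ i =>
      cases j using Fin.cases with
      | zero => exact h2 i
      | succ j => exact h1 i j
  simpa using LinearMap.finrank_le_finrank_of_injective hφ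

end ZeroMargins

section BlockMatrix

/-- The `0/1` matrix with ones at the positions `i ≡ j [MOD g]`. -/
def congruenceMatrix (m n g : ℕ) : Fin m × Fin n → ℤ :=
  fun e => if (e.1 : ℕ) ≡ e.2 [MOD g] then 1 else 0

lemma sum_modEq {n g : ℕ} (hg : 0 < g) (h : g ∣ n) (a : ℕ) :
    ∑ j : Fin n, (if (j : ℕ) ≡ a [MOD g] then (1 : ℤ) else 0) = (n / g : ℕ) := by
  rw [Fin.sum_univ_eq_sum_range (fun j => if j ≡ a [MOD g] then (1 : ℤ) else 0), sum_boole,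
    ← Nat.count_eq_card_filter_range, Nat.count_modEq_card n hg, Nat.mod_eq_zero_of_dvd h]
  simp

lemma sub_smul_congruenceMatrix_mem_iff {m n g : ℕ} (hg : 0 < g) (hm : g ∣ m) (hn : g ∣ n) (r : ℕ)
    (x : Fin m × Fin n → ℤ) :
    x - (r : ℤ) • congruenceMatrix m n g ∈ intLattice (zeroMargins (Fin m) (Fin n)) ↔
      (∀ i, ∑ j, x (i, j) = r * (n / g : ℕ)) ∧ ∀ j, ∑ i, x (i, j) = r * (m / g : ℕ) := by
  have hr (i : Fin m) : ∑ j, congruenceMatrix m n g (i, j) = (n / g : ℕ) := by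
    rw [← sum_modEq hg hn i]
    exact sum_congr rfl fun j _ => by simp only [congruenceMatrix, Nat.ModEq.comm]
  have hc (j : Fin n) : ∑ i, congruenceMatrix m n g (i, j) = (m / g : ℕ) := sum_modEq hg hm j
  rw [mem_intLattice, mem_zeroMargins]
  simp only [← Int.cast_sum, Int.cast_eq_zero, Pi.sub_apply, Pi.smul_apply, smul_eq_mul,
    sum_sub_distrib, ← mul_sum, hr, hc, sub_eq_zero]

lemma matCount_eq_card_dilatePoints {m n g : ℕ} (hg : 0 < g) (hm : g ∣ m) (hn : g ∣ n)
    (hs : DilatesBounded (zeroMargins (Fin m) (Fin n)) (congruenceMatrix m n g) (n / g)) (q : ℕ) :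
    matCount m (q * (n / g)) n (q * (m / g)) =
      #(dilatePoints (zeroMargins (Fin m) (Fin n)) (congruenceMatrix m n g) (n / g) q) := by
  have hiff (x : Fin m × Fin n → ℤ) : x ∈ dilatePoints (zeroMargins (Fin m) (Fin n))
      (congruenceMatrix m n g) (n / g) q ↔ (∀ e, 0 ≤ x e) ∧
      (∀ i, ∑ j, x (i, j) = q * (n / g : ℕ)) ∧ ∀ j, ∑ i, x (i, j) = q * (m / g : ℕ) := by
    rw [mem_dilatePoints hs, sub_smul_congruenceMatrix_mem_iff hg hm hn]
  rw [matCount, ← Fintype.card_coe, ← Nat.card_eq_fintype_card]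
  refine Nat.card_congr
    { toFun := fun A => ⟨fun e => (A.1 e.1 e.2 : ℤ), (hiff _).2 ⟨fun e => by positivity, ?_, ?_⟩⟩
      invFun := fun x => ⟨fun i j => (x.1 (i, j)).toNat, ?_, ?_⟩
      left_inv := fun A => by ext; simp
      right_inv := fun x => by
        ext e
        simpa using ((hiff _).1 x.2).1 e }
  · exact fun i => by exact_mod_cast A.2.1 i
  · exact fun j => by exact_mod_cast A.2.2 j
  · intro i
    obtain ⟨h0, h1, -⟩ := (hiff _).1 x.2
    rw [← Nat.cast_inj (R := ℤ), Nat.cast_sum, Nat.cast_mul, ← h1 i]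
    exact sum_congr rfl fun j _ => Int.toNat_of_nonneg (h0 _)
  · intro j
    obtain ⟨h0, -, h1⟩ := (hiff _).1 x.2
    rw [← Nat.cast_inj (R := ℤ), Nat.cast_sum, Nat.cast_mul, ← h1 j]
    exact sum_congr rfl fun i _ => Int.toNat_of_nonneg (h0 _)

lemma dilatesBounded_congruenceMatrix {m n g : ℕ} (hg : 0 < g) (hm : g ∣ m) (hn : g ∣ n) :
    DilatesBounded (zeroMargins (Fin m) (Fin n)) (congruenceMatrix m n g) (n / g) := by
  rintro r x hx hmem ⟨i, j⟩
  rw [mul_comm, ← ((sub_smul_congruenceMatrix_mem_iff hg hm hn r x).1 hmem).1 i]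
  exact single_le_sum (f := fun j => x (i, j)) (fun j _ => hx _) (mem_univ j)

end BlockMatrix

lemma lcm_div_left_eq {m : ℕ} (n : ℕ) (hm : 0 < m) : m.lcm n / m = n / m.gcd n := by
  rw [Nat.lcm, Nat.mul_div_assoc _ (Nat.gcd_dvd_right m n), Nat.mul_div_cancel_left _ hm]

/-- Stanley's nonnegativity applied to the transportation polytope: with
`s₀ = lcm(m,n)/m`, `t₀ = lcm(m,n)/n` and `d = (m−1)(n−1)`, there is a nonnegative
function `g` on `{0,…,d}` such that for all integers `q ≥ d`,
`M(m, qs₀; n, qt₀) = binom(q,d) ∑_{X ⊆ {0,…,d−1}} g(|X|) / ∏_{j∈X}(q−j)`. -/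
theorem stmt_15 (m n : ℕ) (hm : 2 ≤ m) (hn : 2 ≤ n) :
    ∃ g : ℕ → ℝ, (∀ k ≤ (m - 1) * (n - 1), 0 ≤ g k) ∧
      ∀ q : ℕ, (m - 1) * (n - 1) ≤ q →
        (matCount m (q * (Nat.lcm m n / m)) n (q * (Nat.lcm m n / n)) : ℝ)
          = (q.choose ((m - 1) * (n - 1)) : ℝ)
              * ∑ X ∈ (Finset.range ((m - 1) * (n - 1))).powerset,
                  g X.card / ∏ j ∈ X, ((q : ℝ) - (j : ℝ)) := by
  have hg : 0 < m.gcd n := Nat.gcd_pos_of_pos_left _ (by omega)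
  have hs := dilatesBounded_congruenceMatrix hg (Nat.gcd_dvd_left m n) (Nat.gcd_dvd_right m n)
  have hcount := matCount_eq_card_dilatePoints hg (Nat.gcd_dvd_left m n) (Nat.gcd_dvd_right m n) hs
  have hpos := rounds_zeroMargins.binomPos_card_dilatePoints (v := congruenceMatrix m n (m.gcd n))
    (fun e => by unfold congruenceMatrix; split_ifs <;> simp)
    ⟨(⟨0, by omega⟩, ⟨0, by omega⟩), if_pos rfl⟩ hs
  have hdim : Module.finrank ℚ (zeroMargins (Fin m) (Fin n)) ≤ (m - 1) * (n - 1) := by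
    obtain ⟨m, rfl⟩ := Nat.exists_eq_add_of_le' (show 1 ≤ m by omega)
    obtain ⟨n, rfl⟩ := Nat.exists_eq_add_of_le' (show 1 ≤ n by omega)
    exact finrank_zeroMargins_le m n
  obtain ⟨g, hg0, hgf⟩ := (hpos.mono hdim).exists_eq_choose_mul_sum
  refine ⟨g, fun k _ => hg0 k, fun q hq => ?_⟩
  rw [lcm_div_left_eq n (by omega), Nat.lcm_comm, lcm_div_left_eq m (by omega), Nat.gcd_comm n m,
    hcount q, hgf q hq]
end

section
/- Let ε > 0, let λ > 0, let m, n be positive integers, set N = ⌈6000(1+λ)⌉, δ = 2π/N, and x_ℓ = ℓδ for 0 ≤ ℓ ≤ N−1. For (θ,φ) ∈ [−π,π]^{m}×[−π,π]^{n}, regarded modulo 2π, define: (θ,φ) ∈ 𝒜 if cos(θ_j + φ_k) ≤ cos δ for at least (1/3)·min(m n^ε, m^ε n) of the pairs (j,k) with 1 ≤ j ≤ m, 1 ≤ k ≤ n; and (θ,φ) ∈ ℛ₁(ℓ) if the number of indices j with θ_j within circular distance 4δ of x_ℓ is at least m − m^ε and the number of indices k with φ_k within circular distance 4δ of −x_ℓ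 is at least n − n^ε. Then every point of [−π,π]^{m+n} lies in 𝒜 ∪ ℛ₁(0) ∪ ℛ₁(1) ∪ ⋯ ∪ ℛ₁(N−1). -/
open Real

/-- If a set `S` of pairs is small compared with both `|α| * C` and `A * |β|`, then some pair outside
`S` has at most `C` elements of `S` in its row and at most `A` elements of `S` in its column. -/
lemma exists_notMem_card_row_le_card_col_le {α β : Type*} [Fintype α] [Fintype β]
    [DecidableEq α] [DecidableEq β] [Nonempty β] (S : Finset (α × β)) {A C : ℝ}
    (hA : 0 ≤ A) (hCβ : C ≤ Fintype.card β)
    (hSC : (S.card : ℝ) < 1 / 3 * (Fintype.card α * C))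
    (hSA : (S.card : ℝ) < 1 / 3 * (A * Fintype.card β)) :
    ∃ j k, (j, k) ∉ S ∧ ((Finset.univ.filter fun k' => (j, k') ∈ S).card : ℝ) ≤ C ∧
      ((Finset.univ.filter fun j' => (j', k) ∈ S).card : ℝ) ≤ A := by
  have hrow : (S.card : ℝ) = ∑ j, ((Finset.univ.filter fun k' => (j, k') ∈ S).card : ℝ) := by
    have h : S.card = ∑ j, (Finset.univ.filter fun k' => (j, k') ∈ S).card := by
      simp only [Finset.card_filter]
      rw [← Fintype.sum_prod_type' (fun j k => if (j, k) ∈ S then 1 else 0)]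
      simp
    exact_mod_cast h
  have hcol : (S.card : ℝ) = ∑ k, ((Finset.univ.filter fun j' => (j', k) ∈ S).card : ℝ) := by
    have h : S.card = ∑ k, (Finset.univ.filter fun j' => (j', k) ∈ S).card := by
      simp only [Finset.card_filter]
      rw [← Fintype.sum_prod_type_right' (fun j k => if (j, k) ∈ S then 1 else 0)]
      simp
    exact_mod_cast h
  obtain ⟨j, hj⟩ : ∃ j, ((Finset.univ.filter fun k' => (j, k') ∈ S).card : ℝ) < C / 3 := by
    by_contra! h
    have := Finset.card_nsmul_le_sum Finset.univ _ _ fun j _ => h j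
    rw [← hrow, nsmul_eq_mul, Finset.card_univ] at this
    linarith
  have hG : ((Finset.univ.filter fun k' => (j, k') ∈ S).card : ℝ) +
      (Finset.univ.filter fun k' => (j, k') ∉ S).card = Fintype.card β := by
    exact_mod_cast Finset.card_filter_add_card_filter_not (s := Finset.univ) fun k' => (j, k') ∈ S
  obtain ⟨k, hk, hkA⟩ : ∃ k, (j, k) ∉ S ∧
      ((Finset.univ.filter fun j' => (j', k) ∈ S).card : ℝ) ≤ A := by
    by_contra! h
    have h1 := Finset.card_nsmul_le_sum (Finset.univ.filter fun k' => (j, k') ∉ S)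
      (fun k => ((Finset.univ.filter fun j' => (j', k) ∈ S).card : ℝ)) A
      fun k hk => (h k (Finset.mem_filter.1 hk).2).le
    have h2 := h1.trans (Finset.sum_le_univ_sum_of_nonneg fun _ => Nat.cast_nonneg _)
    rw [← hcol, nsmul_eq_mul] at h2
    have h3 : (1 / 3 * (Fintype.card β : ℝ)) * A ≤
        (Finset.univ.filter fun k' => (j, k') ∉ S).card * A :=
      mul_le_mul_of_nonneg_right (by linarith) hA
    linarith
  exact ⟨j, k, hk, by linarith, hkA⟩

lemma card_sub_le_card_filter {α : Type*} [Fintype α] {p q : α → Prop} [DecidablePred p]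
    [DecidablePred q] {A : ℝ} (hA : ((Finset.univ.filter p).card : ℝ) ≤ A)
    (hpq : ∀ a, ¬ p a → q a) :
    (Fintype.card α : ℝ) - A ≤ ((Finset.univ.filter q).card : ℝ) := by
  have h1 : ((Finset.univ.filter p).card : ℝ) + (Finset.univ.filter fun a => ¬ p a).card =
      Fintype.card α := by
    exact_mod_cast Finset.card_filter_add_card_filter_not (s := Finset.univ) p
  have h2 : ((Finset.univ.filter fun a => ¬ p a).card : ℝ) ≤ (Finset.univ.filter q).card := by
    exact_mod_cast Finset.card_le_card (Finset.monotone_filter_right _ fun a _ ha => hpq a ha)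
  linarith

lemma abs_toIocMod_neg_pi_le {x c : ℝ} (hc : c < π) (z : ℤ) (h : |x - z * (2 * π)| ≤ c) :
    |toIocMod Real.two_pi_pos (-π) x| ≤ c := by
  have h' := abs_le.1 h
  have : toIocMod Real.two_pi_pos (-π) x = x - z * (2 * π) := by
    rw [toIocMod_eq_iff]
    refine ⟨⟨by linarith, by linarith⟩, z, ?_⟩
    rw [zsmul_eq_mul]
    ring
  rwa [this]

lemma exists_abs_sub_lt_of_cos_lt {x δ : ℝ} (hδ : 0 ≤ δ) (h : Real.cos δ < Real.cos x) :
    ∃ z : ℤ, |x - z * (2 * π)| < δ := by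
  refine ⟨toIocDiv Real.two_pi_pos (-π) x, ?_⟩
  have hmem := toIocMod_mem_Ioc Real.two_pi_pos (-π) x
  rw [toIocMod, zsmul_eq_mul] at hmem
  by_contra! hle
  have := Real.cos_le_cos_of_nonneg_of_le_pi hδ
    (abs_le.2 ⟨hmem.1.le, by linarith [hmem.2]⟩) hle
  rw [Real.cos_abs, Real.cos_sub_int_mul_two_pi] at this
  linarith

lemma exists_lt_abs_sub_mul_le {N : ℕ} (hN : 0 < N) (a : ℝ) :
    ∃ ℓ : ℕ, ℓ < N ∧ ∃ z : ℤ, |a - ℓ * (2 * π / N) - z * (2 * π)| ≤ 2 * π / N := by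
  have hN' : (0 : ℝ) < N := by exact_mod_cast hN
  have hδ : 0 < 2 * π / N := by positivity
  have hmem := toIcoMod_mem_Ico Real.two_pi_pos 0 a
  have hdef : toIcoMod Real.two_pi_pos 0 a = a - toIcoDiv Real.two_pi_pos 0 a * (2 * π) := by
    rw [toIcoMod, zsmul_eq_mul]
  set b := toIcoMod Real.two_pi_pos 0 a
  have hb : 0 ≤ b / (2 * π / N) := div_nonneg hmem.1 hδ.le
  refine ⟨⌊b / (2 * π / N)⌋₊, ?_, toIcoDiv Real.two_pi_pos 0 a, ?_⟩
  · rw [Nat.floor_lt hb, div_lt_iff₀ hδ, mul_div_cancel₀ _ hN'.ne']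
    linarith [hmem.2]
  · have h1 := (le_div_iff₀ hδ).1 (Nat.floor_le hb)
    have h2 := (div_lt_iff₀ hδ).1 (Nat.lt_floor_add_one (b / (2 * π / N)))
    rw [abs_le]
    constructor <;> linarith

open scoped Classical in
/-- The covering claim (equation (4.2) of the paper): with `N = ⌈6000(1+λ)⌉`,
`δ = 2π/N` and `x_ℓ = ℓδ`, every point of `[−π,π]^{m+n}` lies in
`𝒜 ∪ ℛ₁(0) ∪ ⋯ ∪ ℛ₁(N−1)`, where `𝒜` is the set of `(θ,φ)` such that
`cos(θ_j+φ_k) ≤ cos δ` for at least `(1/3)min(mn^ε, m^ε n)` pairs `(j,k)`, and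
`ℛ₁(ℓ)` is the set of `(θ,φ)` with at least `m − m^ε` of the `θ_j` within circular
distance `4δ` of `x_ℓ` and at least `n − n^ε` of the `φ_k` within circular distance
`4δ` of `−x_ℓ`.  Circular distance on `ℝ/2πℤ` is expressed via `toIocMod`, which
reduces a real number modulo `2π` to a representative in `(−π, π]`. -/
theorem stmt_18 (ε : ℝ) (hε : 0 < ε) (lam : ℝ) (hlam : 0 < lam)
    (m n : ℕ) (hm : 0 < m) (hn : 0 < n)
    (θ : Fin m → ℝ) (φ : Fin n → ℝ)
    (hθ : ∀ j, θ j ∈ Set.Icc (-π) π) (hφ : ∀ k, φ k ∈ Set.Icc (-π) π) :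
    (1 / 3 * min ((m : ℝ) * (n : ℝ) ^ ε) ((m : ℝ) ^ ε * (n : ℝ))
        ≤ ((Finset.univ.filter fun p : Fin m × Fin n =>
              Real.cos (θ p.1 + φ p.2)
                ≤ Real.cos (2 * π / (⌈6000 * (1 + lam)⌉₊ : ℝ))).card : ℝ))
    ∨ ∃ ℓ : ℕ, ℓ < ⌈6000 * (1 + lam)⌉₊ ∧
        ((m : ℝ) - (m : ℝ) ^ ε
            ≤ ((Finset.univ.filter fun j : Fin m =>
                  |toIocMod Real.two_pi_pos (-π)
                      (θ j - ℓ * (2 * π / (⌈6000 * (1 + lam)⌉₊ : ℝ)))|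
                    ≤ 4 * (2 * π / (⌈6000 * (1 + lam)⌉₊ : ℝ))).card : ℝ))
        ∧ ((n : ℝ) - (n : ℝ) ^ ε
            ≤ ((Finset.univ.filter fun k : Fin n =>
                  |toIocMod Real.two_pi_pos (-π)
                      (φ k - (-(ℓ * (2 * π / (⌈6000 * (1 + lam)⌉₊ : ℝ)))))|
                    ≤ 4 * (2 * π / (⌈6000 * (1 + lam)⌉₊ : ℝ))).card : ℝ)) := by
  have hNr : (6000 : ℝ) ≤ (⌈6000 * (1 + lam)⌉₊ : ℝ) :=
    le_trans (by linarith) (Nat.le_ceil _)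
  have hN : 0 < ⌈6000 * (1 + lam)⌉₊ := by
    have : (0 : ℝ) < (⌈6000 * (1 + lam)⌉₊ : ℝ) := by linarith
    exact_mod_cast this
  have hm1 : (1 : ℝ) ≤ m := by exact_mod_cast hm
  have hn1 : (1 : ℝ) ≤ n := by exact_mod_cast hn
  have hcover := fun a => exists_lt_abs_sub_mul_le hN a
  generalize ⌈6000 * (1 + lam)⌉₊ = N at hNr hN hcover ⊢
  rcases le_total 1 ε with h1 | h1
  · refine Or.inr ⟨0, hN, ?_, ?_⟩
    · exact (sub_nonpos.2 (Real.self_le_rpow_of_one_le hm1 h1)).trans (Nat.cast_nonneg _)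
    · exact (sub_nonpos.2 (Real.self_le_rpow_of_one_le hn1 h1)).trans (Nat.cast_nonneg _)
  rw [or_iff_not_imp_left, not_le]
  intro hS
  have hδ : 0 < 2 * π / (N : ℝ) := div_pos Real.two_pi_pos (by linarith)
  have hδπ : 4 * (2 * π / (N : ℝ)) < π := by
    rw [← mul_div_assoc, div_lt_iff₀ (by linarith)]
    nlinarith [Real.pi_pos]
  generalize 2 * π / (N : ℝ) = δ at hS hδ hδπ hcover ⊢
  have : Nonempty (Fin n) := ⟨⟨0, hn⟩⟩
  have hA : (0 : ℝ) ≤ (m : ℝ) ^ ε := by positivity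
  obtain ⟨j, k, hjk, hrow, hcol⟩ := exists_notMem_card_row_le_card_col_le _ hA
    (by simpa using Real.rpow_le_self_of_one_le hn1 h1)
    (hS.trans_le (by simp)) (hS.trans_le (by simp))
  have hgood : ∀ {j k}, (j, k) ∉ (Finset.univ.filter fun p : Fin m × Fin n =>
      Real.cos (θ p.1 + φ p.2) ≤ Real.cos δ) → ∃ z : ℤ, |θ j + φ k - z * (2 * π)| < δ := by
    intro j k h
    refine exists_abs_sub_lt_of_cos_lt hδ.le ?_
    simpa using h
  obtain ⟨ℓ, hℓ, z, hz⟩ := hcover (θ j)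
  obtain ⟨w, hw⟩ := hgood hjk
  rw [abs_le] at hz
  rw [abs_lt] at hw
  refine ⟨ℓ, hℓ, ?_, ?_⟩
  · have := card_sub_le_card_filter (q := fun j => |toIocMod Real.two_pi_pos (-π)
      (θ j - ℓ * δ)| ≤ 4 * δ) hcol fun i hi => by
        obtain ⟨v, hv⟩ := hgood hi
        rw [abs_lt] at hv
        refine abs_toIocMod_neg_pi_le hδπ (v - w + z) ?_
        push_cast
        rw [abs_le]
        constructor <;> linarith
    simpa using this
  · have := card_sub_le_card_filter (q := fun k => |toIocMod Real.two_pi_pos (-π)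
      (φ k - (-(ℓ * δ)))| ≤ 4 * δ) hrow fun i hi => by
        obtain ⟨v, hv⟩ := hgood hi
        rw [abs_lt] at hv
        refine abs_toIocMod_neg_pi_le hδπ (v - z) ?_
        push_cast
        rw [abs_le]
        constructor <;> linarith
    simpa using this
end
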